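/- arXiv:2504.18021 — 4 statements merged into one kernel-verified Lean document; each statement's English description precedes it below -/
import Mathlib

section
/- Let R be a commutative artinian ring satisfying property 𝔛. Then R is self-injective, i.e. R is injective as a module over itself. -/
open Submodule

/-- The `i`-th composition factor of a composition series of submodules. -/
abbrev CompFactor {R M : Type} [Ring R] [AddCommGroup M] [Module R M]
    (s : CompositionSeries (Submodule R M)) (i : Fin s.length) :=
  ↥(s i.succ) ⧸ (Submodule.comap (s i.succ).subtype (s i.castSucc))

/-- Two modules have the same composition factors with the same multiplicities. -/
def SameCompFactors (R M N : Type) [Ring R] [AddCommGroup M] [Module R M]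
    [AddCommGroup N] [Module R N] : Prop :=
  ∃ (sM : CompositionSeries (Submodule R M)) (sN : CompositionSeries (Submodule R N)),
    sM.head = ⊥ ∧ sM.last = ⊤ ∧ sN.head = ⊥ ∧ sN.last = ⊤ ∧
    ∃ e : Fin sM.length ≃ Fin sN.length,
      ∀ i, Nonempty ((CompFactor sM i) ≃ₗ[R] (CompFactor sN (e i)))

/-- A module is indecomposable. -/
def IsIndecomposable (R M : Type) [Ring R] [AddCommGroup M] [Module R M] : Prop :=
  Nontrivial M ∧ ∀ A B : Submodule R M, IsCompl A B → A = ⊥ ∨ B = ⊥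

/-- Property 𝔛: finite length indecomposable modules are determined by their
composition factors. -/
def PropertyX (R : Type) [Ring R] : Prop :=
  ∀ (M N : Type) [AddCommGroup M] [Module R M] [AddCommGroup N] [Module R N],
    IsFiniteLength R M → IsFiniteLength R N →
    IsIndecomposable R M → IsIndecomposable R N →
    SameCompFactors R M N → Nonempty (M ≃ₗ[R] N)

section LinearDual

universe u

variable {R : Type*} [CommRing R]

/-- A simple module annihilated by a power of a maximal ideal is its residue field. -/
lemma IsSimpleModule.nonempty_linearEquiv_quotient_of_pow_le_annihilator {F : Type*}
    [AddCommGroup F] [Module R F] [IsSimpleModule R F] (m : Ideal R) [hm : m.IsMaximal] {k : ℕ}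
    (hk : m ^ k ≤ Module.annihilator R F) : Nonempty (F ≃ₗ[R] R ⧸ m) := by
  obtain ⟨J, hJ, ⟨e⟩⟩ := isSimpleModule_iff_quot_maximal.mp ‹IsSimpleModule R F›
  have h : m ^ k ≤ J := by
    rwa [e.annihilator_eq, Ideal.annihilator_quotient] at hk
  obtain rfl := hm.eq_of_le hJ.ne_top (hJ.isPrime.le_of_pow_le h)
  exact ⟨e⟩

lemma Ideal.le_of_pow_le_of_ne_top {m : Ideal R} [hm : m.IsMaximal] {k : ℕ} {I : Ideal R}
    (hk : m ^ k ≤ I) (hI : I ≠ ⊤) : I ≤ m := by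
  obtain ⟨J, hJ, hIJ⟩ := Ideal.exists_le_maximal I hI
  obtain rfl := hm.eq_of_le hJ.ne_top (hJ.isPrime.le_of_pow_le (hk.trans hIJ))
  exact hIJ

/-- If all nonzero maps from a simple module `S` to `Q` have the same range, then `Hom(S, Q)` has
length at most one. -/
lemma Module.length_linearMap_le_one_of_range_eq {S Q : Type*} [AddCommGroup S] [Module R S]
    [IsSimpleModule R S] [AddCommGroup Q] [Module R Q]
    (h : ∀ f g : S →ₗ[R] Q, f ≠ 0 → g ≠ 0 → LinearMap.range f = LinearMap.range g) :
    Module.length R (S →ₗ[R] Q) ≤ 1 := by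
  rcases subsingleton_or_nontrivial (S →ₗ[R] Q) with _ | _
  · simp
  refine (Module.length_eq_one_iff.mpr
    (isSimpleModule_iff_toSpanSingleton_surjective.mpr ⟨inferInstance, fun f hf g ↦ ?_⟩)).le
  by_cases hg : g = 0
  · exact ⟨0, by simp [hg]⟩
  have := IsSimpleModule.nontrivial R S
  obtain ⟨s, hs⟩ := exists_ne (0 : S)
  have hspan := IsSimpleModule.toSpanSingleton_surjective R hs
  obtain ⟨t, ht⟩ : g s ∈ LinearMap.range f := h f g hf hg ▸ LinearMap.mem_range_self g s
  obtain ⟨r, rfl⟩ := hspan t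
  refine ⟨r, LinearMap.ext fun x ↦ ?_⟩
  obtain ⟨a, rfl⟩ := hspan x
  simp only [LinearMap.toSpanSingleton_apply, map_smul, LinearMap.smul_apply] at ht ⊢
  rw [ht]

lemma Module.length_linearMap_eq_add (Q : Type*) [AddCommGroup Q] [Module R Q] {M : Type*}
    [AddCommGroup M] [Module R M] (N : Submodule R M) :
    Module.length R (M →ₗ[R] Q) = Module.length R ((M ⧸ N) →ₗ[R] Q) +
      Module.length R (LinearMap.range (LinearMap.lcomp R Q N.subtype)) := by
  have h := LinearMap.exact_lcomp_of_exact_of_surjective (N := Q) (LinearMap.exact_subtype_mkQ N)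
    N.mkQ_surjective
  refine Module.length_eq_add_of_exact (LinearMap.lcomp R Q N.mkQ)
    (LinearMap.lcomp R Q N.subtype).rangeRestrict
    (LinearMap.lcomp_injective_of_surjective _ N.mkQ_surjective)
    (LinearMap.surjective_rangeRestrict _) fun f ↦ ?_
  rw [← h f, Subtype.ext_iff]
  rfl

/-- If `Hom(S, Q)` has length at most one for every simple `S`, then applying `Hom(-, Q)` does
not increase lengths. -/
lemma IsFiniteLength.length_linearMap_le {Q : Type*} [AddCommGroup Q] [Module R Q]
    {M : Type u} [AddCommGroup M] [Module R M]
    (hQ : ∀ (S : Type u) [AddCommGroup S] [Module R S] [IsSimpleModule R S],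
      Module.length R (S →ₗ[R] Q) ≤ 1)
    (hM : IsFiniteLength R M) : Module.length R (M →ₗ[R] Q) ≤ Module.length R M := by
  induction hM with
  | of_subsingleton => simp
  | @of_simple_quotient M _ _ N _ _ ih =>
    rw [Module.length_linearMap_eq_add Q N,
      Module.length_eq_add_of_exact N.subtype N.mkQ N.injective_subtype N.mkQ_surjective
        (LinearMap.exact_subtype_mkQ N), add_comm]
    refine add_le_add ((Module.length_le_of_injective _ (Submodule.injective_subtype _)).trans ih)
      ((hQ (M ⧸ N)).trans ?_)
    rw [Module.length_eq_one]

/-- An artinian ring `R` with `Hom(S, R)` of length at most one for every simple `S` is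
self-injective. -/
lemma Module.Injective.self_of_length_linearMap_le_one {R : Type u} [CommRing R] [IsArtinianRing R]
    (hR : ∀ (S : Type u) [AddCommGroup S] [Module R S] [IsSimpleModule R S],
      Module.length R (S →ₗ[R] R) ≤ 1) : Module.Injective R R := by
  refine Module.Baer.injective fun I g ↦ ?_
  have hfin (M : Type u) [AddCommGroup M] [Module R M] [Module.Finite R M] :
      IsFiniteLength R M :=
    isFiniteLength_iff_isNoetherian_isArtinian.mpr ⟨inferInstance, inferInstance⟩
  let q : (R →ₗ[R] R) →ₗ[R] (I →ₗ[R] R) := LinearMap.lcomp R R I.subtype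
  have h₁ : Module.length R (R →ₗ[R] R) =
      Module.length R ((R ⧸ I) →ₗ[R] R) + Module.length R (LinearMap.range q) :=
    Module.length_linearMap_eq_add R I
  have h₂ := Module.length_eq_add_of_exact I.subtype I.mkQ I.injective_subtype I.mkQ_surjective
    (LinearMap.exact_subtype_mkQ I)
  have h₃ : Module.length R (R →ₗ[R] R) = Module.length R R :=
    (LinearMap.ringLmapEquivSelf R R R).length_eq
  have h₄ := (hfin (R ⧸ I)).length_linearMap_le hR
  have h₅ := (hfin I).length_linearMap_le hR
  have h₆ : Module.length R (R ⧸ I) ≠ ⊤ := Module.length_ne_top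
  have htop : LinearMap.range q = ⊤ := by
    by_contra hne
    have hI : IsFiniteLength R (I →ₗ[R] R) :=
      Module.length_ne_top_iff.mp (h₅.trans_lt Module.length_ne_top.lt_top).ne
    obtain ⟨_, _⟩ := isFiniteLength_iff_isNoetherian_isArtinian.mp hI
    have h₇ := (Submodule.length_lt hne).trans_le h₅
    have h₈ : Module.length R I + Module.length R (R ⧸ I) ≤
        Module.length R (LinearMap.range q) + Module.length R (R ⧸ I) := by
      rw [← h₂, ← h₃, h₁, add_comm]
      gcongr
    exact (((ENat.add_le_add_iff_right h₆).mp h₈).trans_lt h₇).false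
  obtain ⟨g', hg'⟩ := LinearMap.range_eq_top.mp htop g
  exact ⟨g', fun x hx ↦ LinearMap.congr_fun hg' ⟨x, hx⟩⟩

end LinearDual

section PropertyX

variable {R : Type} [CommRing R]

lemma sameCompFactors_of_length_eq {M N : Type} [AddCommGroup M] [Module R M] [AddCommGroup N]
    [Module R N] (hM : IsFiniteLength R M) (hN : IsFiniteLength R N)
    (m : Ideal R) [m.IsMaximal] {k : ℕ} (hkM : m ^ k ≤ Module.annihilator R M)
    (hkN : m ^ k ≤ Module.annihilator R N) (h : Module.length R M = Module.length R N) :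
    SameCompFactors R M N := by
  obtain ⟨s, hs, hs'⟩ := isFiniteLength_iff_exists_compositionSeries.mp hM
  obtain ⟨t, ht, ht'⟩ := isFiniteLength_iff_exists_compositionSeries.mp hN
  have hlen : s.length = t.length := by
    have := Module.length_compositionSeries s hs hs'
    rw [h, ← Module.length_compositionSeries t ht ht'] at this
    exact_mod_cast this
  have key {L : Type} [AddCommGroup L] [Module R L] (hkL : m ^ k ≤ Module.annihilator R L)
      (u : CompositionSeries (Submodule R L)) (i : Fin u.length) :
      Nonempty (CompFactor u i ≃ₗ[R] R ⧸ m) := by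
    have : IsSimpleModule R (CompFactor u i) :=
      (covBy_iff_quot_is_simple (u.step i).le).mp (u.step i)
    refine IsSimpleModule.nonempty_linearEquiv_quotient_of_pow_le_annihilator m (hkL.trans ?_)
    exact ((u i.succ).subtype.annihilator_le_of_injective (Submodule.injective_subtype _)).trans
      ((Submodule.mkQ _).annihilator_le_of_surjective (Submodule.mkQ_surjective _))
  refine ⟨s, t, hs, hs', ht, ht', finCongr hlen, fun i ↦ ?_⟩
  obtain ⟨e⟩ := key hkM s i
  obtain ⟨e'⟩ := key hkN t (finCongr hlen i)
  exact ⟨e.trans e'.symm⟩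

lemma isIndecomposable_quotient_of_pow_le (m : Ideal R) [hm : m.IsMaximal] {k : ℕ} {I : Ideal R}
    (hk : m ^ k ≤ I) (hI : I ≠ ⊤) : IsIndecomposable R (R ⧸ I) := by
  refine ⟨Ideal.Quotient.nontrivial_iff.mpr hI, fun A B hAB ↦ ?_⟩
  have key (C : Submodule R (R ⧸ I)) (hC : C ≠ ⊤) : C ≤ Submodule.map I.mkQ m := by
    rw [← C.map_comap_eq_of_surjective I.mkQ_surjective]
    refine Submodule.map_mono (Ideal.le_of_pow_le_of_ne_top (k := k) ?_ ?_)
    · exact hk.trans (Submodule.le_comap_mkQ I C)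
    · intro h
      apply hC
      rw [← C.map_comap_eq_of_surjective I.mkQ_surjective, h, Submodule.map_top, I.range_mkQ]
  by_contra! hne
  have h : Submodule.map I.mkQ m = ⊤ := top_le_iff.mp <| hAB.sup_eq_top ▸ sup_le
    (key A fun hA ↦ hne.2 (by simpa [hA] using hAB.inf_eq_bot))
    (key B fun hB ↦ hne.1 (by simpa [hB] using hAB.inf_eq_bot))
  have h' := congrArg (Submodule.comap I.mkQ) h
  rw [Submodule.comap_map_mkQ, Submodule.comap_top,
    sup_eq_right.mpr (Ideal.le_of_pow_le_of_ne_top hk hI)] at h'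
  exact hm.ne_top h'

lemma PropertyX.ideal_eq_of_length_quotient_eq [IsArtinianRing R] (hR : PropertyX R)
    (m : Ideal R) [m.IsMaximal] {k : ℕ} {I J : Ideal R} (hI : m ^ k ≤ I) (hJ : m ^ k ≤ J)
    (h : Module.length R (R ⧸ I) = Module.length R (R ⧸ J)) : I = J := by
  have htop : I = ⊤ ↔ J = ⊤ := by
    rw [← Ideal.Quotient.subsingleton_iff, ← Ideal.Quotient.subsingleton_iff,
      ← Module.length_eq_zero_iff (R := R), h, Module.length_eq_zero_iff]
  by_cases hIt : I = ⊤
  · rw [hIt, htop.mp hIt]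
  have hfin (L : Ideal R) : IsFiniteLength R (R ⧸ L) :=
    isFiniteLength_iff_isNoetherian_isArtinian.mpr ⟨inferInstance, inferInstance⟩
  obtain ⟨e⟩ := hR (R ⧸ I) (R ⧸ J) (hfin I) (hfin J)
    (isIndecomposable_quotient_of_pow_le m hI hIt)
    (isIndecomposable_quotient_of_pow_le m hJ (mt htop.mpr hIt))
    (sameCompFactors_of_length_eq (hfin I) (hfin J) m
      (by rwa [Ideal.annihilator_quotient]) (by rwa [Ideal.annihilator_quotient]) h)
  simpa [Ideal.annihilator_quotient] using e.annihilator_eq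

/-- Some positive power of an ideal `m` of an artinian ring meets the annihilator of `m`
trivially. -/
lemma IsArtinianRing.exists_pow_disjoint [IsArtinianRing R] (m : Ideal R) :
    ∃ k : ℕ, ∀ x ∈ m ^ k, (∀ a ∈ m, a * x = 0) → x = 0 := by
  obtain ⟨n, hn⟩ := IsArtinian.monotone_stabilizes
    ⟨fun i ↦ OrderDual.toDual (m ^ i), fun i j hij ↦ Ideal.pow_le_pow_right hij⟩
  have hn (j : ℕ) (hj : n ≤ j) : m ^ n = m ^ j := hn j hj
  have hidem : IsIdempotentElem (m ^ (n + 1)) := by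
    rw [IsIdempotentElem, ← pow_add, ← hn (n + 1) (by omega), ← hn _ (by omega)]
  obtain ⟨e, he, hme⟩ := (Ideal.isIdempotentElem_iff_of_fg _ (IsNoetherian.noetherian _)).mp hidem
  refine ⟨n + 1, fun x hx h ↦ ?_⟩
  have hem : e ∈ m := Ideal.pow_le_self n.succ_ne_zero
    (hme ▸ Submodule.mem_span_singleton_self e)
  rw [hme] at hx
  obtain ⟨r, rfl⟩ := Submodule.mem_span_singleton.mp hx
  have := h e hem
  rwa [smul_eq_mul, mul_left_comm, he.eq] at this

/-- Isomorphic simple ideals of an artinian ring with property `𝔛` are equal. -/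
lemma PropertyX.simple_ideal_eq [IsArtinianRing R] (hR : PropertyX R) {S T : Ideal R}
    [IsSimpleModule R S] (e : S ≃ₗ[R] T) : S = T := by
  have hm : (Module.annihilator R S).IsMaximal := IsSimpleModule.annihilator_isMaximal
  set m := Module.annihilator R S with hmS
  obtain ⟨k, hk⟩ := IsArtinianRing.exists_pow_disjoint m
  have hdisj {U : Ideal R} (f : S ≃ₗ[R] U) {x : R} (hx : x ∈ U) : ∀ a ∈ m, a * x = 0 := by
    intro a ha
    rw [hmS, f.annihilator_eq, Module.mem_annihilator] at ha
    exact congrArg Subtype.val (ha ⟨x, hx⟩)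
  have hlen {U : Ideal R} (f : S ≃ₗ[R] U) : Module.length R R =
      Module.length R ↥(m ^ k) + Module.length R S + Module.length R (R ⧸ (m ^ k ⊔ U)) := by
    rw [Module.length_eq_add_of_exact (m ^ k ⊔ U).subtype (m ^ k ⊔ U).mkQ
      (Submodule.injective_subtype _) (Submodule.mkQ_surjective _)
      (LinearMap.exact_subtype_mkQ _), f.length_eq]
    congr 1
    rw [← Module.length_prod]
    let φ : (↥(m ^ k) × U) →ₗ[R] R := (m ^ k).subtype.coprod U.subtype
    have hφ : Function.Injective φ := by
      rw [← LinearMap.ker_eq_bot, LinearMap.ker_coprod_of_disjoint_range]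
      · simp
      · rw [Submodule.range_subtype, Submodule.range_subtype, Submodule.disjoint_def]
        exact fun x hx hxU ↦ hk x hx (hdisj f hxU)
    have hrange : LinearMap.range φ = m ^ k ⊔ U := by simp [φ, LinearMap.range_coprod]
    exact ((LinearEquiv.ofInjective φ hφ).trans (LinearEquiv.ofEq _ _ hrange)).length_eq.symm
  have hsup : m ^ k ⊔ S = m ^ k ⊔ T := by
    refine hR.ideal_eq_of_length_quotient_eq m le_sup_left le_sup_left ?_
    have h := (hlen (.refl R S)).symm.trans (hlen e)
    have hne : Module.length R ↥(m ^ k) + Module.length R S ≠ ⊤ := by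
      simp [Module.length_ne_top]
    exact le_antisymm ((ENat.add_le_add_iff_left hne).mp h.le)
      ((ENat.add_le_add_iff_left hne).mp h.ge)
  have hle {U V : Ideal R} (f : S ≃ₗ[R] U) (g : S ≃ₗ[R] V) (h : m ^ k ⊔ U = m ^ k ⊔ V) :
      U ≤ V := by
    intro x hx
    obtain ⟨y, hy, z, hz, rfl⟩ := Submodule.mem_sup.mp (h ▸ Submodule.mem_sup_right hx :
      x ∈ m ^ k ⊔ V)
    have : y = 0 := hk y hy fun a ha ↦ by
      have h := hdisj f hx a ha
      rwa [mul_add, hdisj g hz a ha, add_zero] at h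
    rwa [this, zero_add]
  exact le_antisymm (hle (.refl R S) e hsup) (hle e (.refl R S) hsup.symm)

end PropertyX

/-- a commutative artinian ring satisfying 𝔛 is self-injective. -/
theorem stmt_4 (R : Type) [CommRing R] [IsArtinianRing R] (hR : PropertyX R) :
    Module.Injective R R := by
  refine Module.Injective.self_of_length_linearMap_le_one fun S _ _ _ ↦
    Module.length_linearMap_le_one_of_range_eq fun f g hf hg ↦ ?_
  let ef := LinearEquiv.ofInjective f (LinearMap.injective_of_ne_zero hf)
  let eg := LinearEquiv.ofInjective g (LinearMap.injective_of_ne_zero hg)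
  have : IsSimpleModule R (LinearMap.range f) := IsSimpleModule.congr ef.symm
  exact hR.simple_ideal_eq (ef.symm.trans eg)
end

section
/- Let R be a commutative artinian ring. If R satisfies property 𝔛, then R is of finite representation type; conversely, if R is of finite representation type then R satisfies property 𝔛. -/
open Submodule

/-- A ring has finite representation type if there are finitely many isomorphism classes
of finitely generated indecomposable modules. -/
def FiniteRepType (R : Type) [Ring R] : Prop :=
  ∃ (ι : Type) (_ : Finite ι) (M : ι → Type) (_ : ∀ i, AddCommGroup (M i))
    (_ : ∀ i, Module R (M i)),
    ∀ (N : Type) (_ : AddCommGroup N) (_ : Module R N),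
      Module.Finite R N → IsIndecomposable R N → ∃ i, Nonempty (N ≃ₗ[R] M i)

/-- Elements of a ring in which every nonunit is divisible by a fixed nilpotent element. -/
theorem exists_eq_pow_mul_isUnit {S : Type*} [CommRing S] {π : S} (hu : ∀ s, π ∣ s ∨ IsUnit s)
    {n : ℕ} (hn : π ^ n = 0) (s : S) : ∃ i ≤ n, ∃ u, IsUnit u ∧ s = π ^ i * u := by
  have key : ∀ k, (∃ i ≤ k, ∃ u, IsUnit u ∧ s = π ^ i * u) ∨ π ^ k ∣ s := by
    intro k
    induction k with
    | zero => simp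
    | succ k ih =>
      obtain ⟨i, hi, u, h⟩ | ⟨t, rfl⟩ := ih
      · exact .inl ⟨i, by omega, u, h⟩
      · obtain ⟨r, rfl⟩ | h := hu t
        · exact .inr ⟨r, by ring⟩
        · exact .inl ⟨k, by omega, t, h, rfl⟩
  obtain h | h := key n
  · exact h
  · rw [hn, zero_dvd_iff] at h
    exact ⟨n, le_rfl, 1, isUnit_one, by simp [h, hn]⟩

theorem Ideal.exists_eq_span_pow {S : Type*} [CommRing S] {π : S} (hu : ∀ s, π ∣ s ∨ IsUnit s)
    {n : ℕ} (hn : π ^ n = 0) (I : Ideal S) : ∃ i ≤ n, I = Ideal.span {π ^ i} := by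
  classical
  have hex : ∃ i, π ^ i ∈ I := ⟨n, by simp [hn]⟩
  refine ⟨Nat.find hex, Nat.find_min' hex (by simp [hn]), le_antisymm (fun s hs ↦ ?_) ?_⟩
  · obtain ⟨i, -, u, hu', rfl⟩ := exists_eq_pow_mul_isUnit hu hn s
    rw [Ideal.mem_span_singleton]
    exact (pow_dvd_pow π (Nat.find_min' hex ((Ideal.mul_unit_mem_iff_mem I hu').1 hs))).mul_right u
  · rw [Ideal.span_singleton_le_iff_mem]
    exact Nat.find_spec hex

theorem Module.Baer.self_of_isNilpotent {S : Type*} [CommRing S] {π : S}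
    (hu : ∀ s, π ∣ s ∨ IsUnit s) (hπ : IsNilpotent π) : Module.Baer S S := by
  classical
  intro I f
  set n := Nat.find hπ
  have hn : π ^ n = 0 := Nat.find_spec hπ
  obtain ⟨i, hi, rfl⟩ := Ideal.exists_eq_span_pow hu hn I
  have hmem : π ^ i ∈ Ideal.span {π ^ i} := Ideal.mem_span_singleton_self _
  obtain ⟨j, -, u, hu', hj⟩ := exists_eq_pow_mul_isUnit hu hn (f ⟨π ^ i, hmem⟩)
  have h0 : π ^ (n - i + j) = 0 := by
    have : π ^ (n - i) • f ⟨π ^ i, hmem⟩ = 0 := by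
      rw [← map_smul]
      convert map_zero f
      simp [← pow_add, Nat.sub_add_cancel hi, hn]
    rw [hj, smul_eq_mul, ← mul_assoc, ← pow_add] at this
    exact hu'.mul_left_eq_zero.1 this
  have hij : i ≤ j := by
    have := Nat.find_min' hπ h0
    omega
  refine ⟨LinearMap.mulLeft S (π ^ (j - i) * u), fun x hx ↦ ?_⟩
  obtain ⟨a, rfl⟩ := Ideal.mem_span_singleton'.1 hx
  have : (⟨a * π ^ i, hx⟩ : Ideal.span {π ^ i}) = a • ⟨π ^ i, hmem⟩ := rfl
  rw [this, map_smul, hj, smul_eq_mul, LinearMap.mulLeft_apply]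
  conv_rhs => rw [← Nat.sub_add_cancel hij, pow_add]
  ring

theorem isIndecomposable_iff {R M : Type} [Ring R] [AddCommGroup M] [Module R M] :
    IsIndecomposable R M ↔
      Nontrivial M ∧ ∀ e : Module.End R M, IsIdempotentElem e → e = 0 ∨ e = 1 := by
  refine and_congr_right fun _ ↦ ⟨fun h e he ↦ ?_, fun h A B hAB ↦ ?_⟩
  · obtain h | h := h _ _ (LinearMap.IsIdempotentElem.isCompl he)
    · exact .inl (LinearMap.range_eq_bot.1 h)
    · right
      ext x
      have : e x - x ∈ LinearMap.ker e := by
        have := LinearMap.congr_fun he x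
        simpa [sub_eq_zero] using this
      rw [h, Submodule.mem_bot, sub_eq_zero] at this
      exact this
  · obtain h | h := h (A.projection B hAB) (by
      ext x
      exact Submodule.projection_apply_of_mem_left hAB (Submodule.projection_apply_mem hAB x))
    · left
      rw [← Submodule.range_projection hAB, h, LinearMap.range_zero]
    · right
      rw [← Submodule.ker_projection hAB, h]
      exact LinearMap.ker_id

/-- A faithful indecomposable module over a ring with a nilpotent element dividing all nonunits
is free of rank one. -/
theorem IsIndecomposable.nonempty_equiv_self {S N : Type} [CommRing S] [AddCommGroup N]
    [Module S N] {π : S} (hu : ∀ s, π ∣ s ∨ IsUnit s) (hπ : IsNilpotent π)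
    (hN : IsIndecomposable S N) (hf : Module.annihilator S N = ⊥) : Nonempty (S ≃ₗ[S] N) := by
  classical
  have hS : ∀ s : S, (∀ z : N, s • z = 0) → s = 0 := fun s hs ↦ by
    rwa [← Module.mem_annihilator, hf] at hs
  have := hN.1
  have := Module.nontrivial S N
  set n := Nat.find hπ
  have hn : π ^ n = 0 := Nat.find_spec hπ
  have hn0 : n ≠ 0 := fun h ↦ by simp [h] at hn
  obtain ⟨z, hz⟩ : ∃ z : N, π ^ (n - 1) • z ≠ 0 := by
    by_contra! h
    exact Nat.find_min hπ (show n - 1 < n by omega) (hS _ h)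
  have hinj : Function.Injective (LinearMap.toSpanSingleton S N z) := by
    rw [injective_iff_map_eq_zero]
    intro s hs
    obtain ⟨i, hi, u, hu', rfl⟩ := exists_eq_pow_mul_isUnit hu hn s
    obtain rfl | hi := hi.eq_or_lt
    · simp [hn]
    · refine absurd ?_ hz
      have h1 : π ^ i • z = 0 := by
        rw [LinearMap.toSpanSingleton_apply, mul_comm, mul_smul] at hs
        exact (IsUnit.smul_eq_zero hu').1 hs
      rw [show n - 1 = (n - 1 - i) + i by omega, pow_add, mul_smul, h1, smul_zero]
  obtain ⟨g, hg⟩ := ((Module.Baer.self_of_isNilpotent hu hπ).injective).out _ hinj LinearMap.id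
  obtain h | h := (isIndecomposable_iff.1 hN).2 (LinearMap.toSpanSingleton S N z ∘ₗ g) (by
    ext x
    simp only [Module.End.mul_apply, LinearMap.comp_apply, hg]
    rfl)
  · have := hg 1
    have h2 := LinearMap.congr_fun h z
    have h3 := hinj (h2.trans (map_zero _).symm)
    rw [LinearMap.toSpanSingleton_apply, one_smul, h3] at this
    exact absurd this zero_ne_one
  · exact ⟨LinearEquiv.ofBijective _ ⟨hinj, fun x ↦ ⟨g x, LinearMap.congr_fun h x⟩⟩⟩

section

variable {R : Type} [CommRing R] {m : Ideal R} {π : R}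

theorem Ideal.exists_le_span_sup_sq [IsNoetherianRing R]
    (h : ∀ x ∈ m, ∀ y ∈ m, x ∈ Ideal.span {y} ⊔ m ^ 2 ∨ y ∈ Ideal.span {x} ⊔ m ^ 2) :
    ∃ π ∈ m, m ≤ Ideal.span {π} ⊔ m ^ 2 := by
  obtain ⟨_, ⟨π, hπ, rfl⟩, hmax⟩ := set_has_maximal_iff_noetherian.2 ‹IsNoetherianRing R›
    ((fun x ↦ Ideal.span {x} ⊔ m ^ 2) '' m) ⟨_, 0, m.zero_mem, rfl⟩
  refine ⟨π, hπ, fun x hx ↦ ?_⟩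
  by_contra hcon
  have hπx := (h x hx π hπ).resolve_left hcon
  refine hmax _ ⟨x, hx, rfl⟩ (lt_of_le_of_ne (sup_le ?_ le_sup_right) fun heq ↦ hcon ?_)
  · rwa [Ideal.span_singleton_le_iff_mem]
  · rw [show Ideal.span {π} ⊔ m ^ 2 = _ from heq]
    exact Ideal.mem_sup_left (Ideal.mem_span_singleton_self x)

theorem Ideal.le_span_sup_pow (h : m ≤ Ideal.span {π} ⊔ m ^ 2) (k : ℕ) :
    m ≤ Ideal.span {π} ⊔ m ^ k := by
  obtain _ | k := k
  · simp
  induction k with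
  | zero => simp
  | succ k ih =>
    refine h.trans (sup_le le_sup_left ?_)
    calc m ^ 2 = m * m := sq m
      _ ≤ m * (Ideal.span {π} ⊔ m ^ (k + 1)) := Ideal.mul_mono_right ih
      _ = m * Ideal.span {π} ⊔ m ^ (k + 1 + 1) := by rw [Ideal.mul_sup, ← pow_succ']
      _ ≤ Ideal.span {π} ⊔ m ^ (k + 1 + 1) := sup_le_sup_right Ideal.mul_le_right _

theorem Ideal.Quotient.isNilpotent_mk {I : Ideal R} {n : ℕ} (hI : m ^ n ≤ I) (hπ : π ∈ m) :
    IsNilpotent (Ideal.Quotient.mk I π) :=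
  ⟨n, by rw [← map_pow]; exact Ideal.Quotient.eq_zero_iff_mem.2 (hI (Ideal.pow_mem_pow hπ n))⟩

theorem Ideal.Quotient.mk_dvd_or_isUnit (hm : m.IsMaximal) (h : m ≤ Ideal.span {π} ⊔ m ^ 2)
    {I : Ideal R} {n : ℕ} (hI : m ^ n ≤ I) (s : R ⧸ I) :
    Ideal.Quotient.mk I π ∣ s ∨ IsUnit s := by
  obtain ⟨r, rfl⟩ := Ideal.Quotient.mk_surjective s
  by_cases hr : r ∈ m
  · left
    obtain ⟨a, ha, w, hw, rfl⟩ := Submodule.mem_sup.1 (Ideal.le_span_sup_pow h n hr)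
    rw [map_add, Ideal.Quotient.eq_zero_iff_mem.2 (hI hw), add_zero]
    exact map_dvd _ (Ideal.mem_span_singleton.1 ha)
  · right
    obtain ⟨b, c, hc, hbc⟩ := hm.exists_inv hr
    have : Ideal.Quotient.mk I b * Ideal.Quotient.mk I r = 1 - Ideal.Quotient.mk I c := by
      rw [← map_mul, ← map_one (Ideal.Quotient.mk I), ← map_sub, ← hbc, add_sub_cancel_right]
    exact isUnit_of_mul_isUnit_right
      (this ▸ (Ideal.Quotient.isNilpotent_mk hI hc).isUnit_one_sub)

theorem Ideal.exists_eq_comap_span_pow (hm : m.IsMaximal) (hπ : π ∈ m)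
    (h : m ≤ Ideal.span {π} ⊔ m ^ 2) {n : ℕ} {I : Ideal R} (hI : m ^ n ≤ I) :
    ∃ i ≤ n, I = (Ideal.span {Ideal.Quotient.mk (m ^ n) π ^ i}).comap
      (Ideal.Quotient.mk (m ^ n)) := by
  obtain ⟨i, hi, hI'⟩ := Ideal.exists_eq_span_pow
    (Ideal.Quotient.mk_dvd_or_isUnit hm h le_rfl) (n := n) (by
      rw [← map_pow]
      exact Ideal.Quotient.eq_zero_iff_mem.2 (Ideal.pow_mem_pow hπ n))
    (I.map (Ideal.Quotient.mk (m ^ n)))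
  refine ⟨i, hi, ?_⟩
  rw [← hI', Ideal.comap_map_of_surjective' _ Ideal.Quotient.mk_surjective, Ideal.mk_ker,
    sup_eq_left.2 hI]

theorem Ideal.le_total_of_pow_le (hm : m.IsMaximal) (hπ : π ∈ m)
    (h : m ≤ Ideal.span {π} ⊔ m ^ 2) {n : ℕ} {I J : Ideal R} (hI : m ^ n ≤ I) (hJ : m ^ n ≤ J) :
    I ≤ J ∨ J ≤ I := by
  obtain ⟨i, -, rfl⟩ := Ideal.exists_eq_comap_span_pow hm hπ h hI
  obtain ⟨j, -, rfl⟩ := Ideal.exists_eq_comap_span_pow hm hπ h hJ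
  obtain hij | hij := le_total j i
  · exact .inl (Ideal.comap_mono (Ideal.span_singleton_le_span_singleton.2 (pow_dvd_pow _ hij)))
  · exact .inr (Ideal.comap_mono (Ideal.span_singleton_le_span_singleton.2 (pow_dvd_pow _ hij)))

theorem Ideal.finite_setOf_pow_le (hm : m.IsMaximal) (hπ : π ∈ m)
    (h : m ≤ Ideal.span {π} ⊔ m ^ 2) (n : ℕ) : {I : Ideal R | m ^ n ≤ I}.Finite := by
  refine ((Set.finite_Iic n).image fun i ↦ (Ideal.span {Ideal.Quotient.mk (m ^ n) π ^ i}).comap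
      (Ideal.Quotient.mk (m ^ n))).subset fun I hI ↦ ?_
  obtain ⟨i, hi, hI⟩ := Ideal.exists_eq_comap_span_pow hm hπ h hI
  exact ⟨i, hi, hI.symm⟩

theorem IsIndecomposable.nonempty_equiv_quotient {N : Type} [AddCommGroup N] [Module R N]
    (hN : IsIndecomposable R N) (hm : m.IsMaximal) (hπ : π ∈ m)
    (h : m ≤ Ideal.span {π} ⊔ m ^ 2) {n : ℕ} (hI : m ^ n ≤ Module.annihilator R N) :
    Nonempty ((R ⧸ Module.annihilator R N) ≃ₗ[R] N) := by
  let _ : Module (R ⧸ Module.annihilator R N) N := (Module.isTorsionBySet_annihilator R N).module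
  have hsmul : ∀ (r : R) (x : N), Ideal.Quotient.mk (Module.annihilator R N) r • x = r • x :=
    fun _ _ ↦ rfl
  have : IsScalarTower R (R ⧸ Module.annihilator R N) N :=
    (Module.isTorsionBySet_annihilator R N).isScalarTower
  have hN' : IsIndecomposable (R ⧸ Module.annihilator R N) N := by
    refine isIndecomposable_iff.2 ⟨hN.1, fun e he ↦ ?_⟩
    refine ((isIndecomposable_iff.1 hN).2 (e.restrictScalars R) (by
      ext x; exact LinearMap.congr_fun he x)).imp (fun h ↦ ?_) (fun h ↦ ?_)
    · ext x
      exact LinearMap.congr_fun h x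
    · ext x
      exact LinearMap.congr_fun h x
  obtain ⟨e⟩ := hN'.nonempty_equiv_self (Ideal.Quotient.mk_dvd_or_isUnit hm h hI)
    (Ideal.Quotient.isNilpotent_mk hI hπ) (by
      refine (Submodule.eq_bot_iff _).2 fun s hs ↦ ?_
      obtain ⟨r, rfl⟩ := Ideal.Quotient.mk_surjective s
      rw [Ideal.Quotient.eq_zero_iff_mem, Module.mem_annihilator]
      exact fun x ↦ Module.mem_annihilator.1 hs x)
  exact ⟨e.restrictScalars R⟩

theorem IsArtinianRing.exists_pow_stable [IsArtinianRing R] (m : Ideal R) :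
    ∃ n, n ≠ 0 ∧ ∀ k, m ^ n ≤ m ^ k := by
  obtain ⟨n, hn⟩ := IsArtinian.monotone_stabilizes
    (⟨fun n ↦ OrderDual.toDual (m ^ n), fun _ _ h ↦ Ideal.pow_le_pow_right h⟩ :
      ℕ →o (Submodule R R)ᵒᵈ)
  refine ⟨n + 1, by omega, fun k ↦ ?_⟩
  have h1 : m ^ n = m ^ (n + 1) := hn (n + 1) (by omega)
  have h2 : m ^ n = m ^ (n + k) := hn (n + k) (by omega)
  rw [← h1, h2]
  exact Ideal.pow_le_pow_right (by omega)

/-- An indecomposable module over an artinian ring is annihilated by a power of a maximal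
ideal. -/
theorem IsIndecomposable.exists_pow_le_annihilator [IsArtinianRing R] {N : Type}
    [AddCommGroup N] [Module R N] (hN : IsIndecomposable R N) :
    ∃ m : Ideal R, m.IsMaximal ∧ ∃ n, m ^ n ≤ Module.annihilator R N := by
  by_contra! hcon
  have := hN.1
  have htop : Module.annihilator R N = ⊤ := by
    by_contra hne
    obtain ⟨m, hm, hle⟩ := Ideal.exists_le_maximal _ hne
    obtain ⟨n, hn0, hn⟩ := IsArtinianRing.exists_pow_stable m
    have hid : IsIdempotentElem (m ^ n) :=
      le_antisymm Ideal.mul_le_left (by rw [← pow_add]; exact hn _)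
    obtain ⟨e, he, hme⟩ :=
      (Ideal.isIdempotentElem_iff_of_fg _ (IsNoetherian.noetherian (m ^ n))).1 hid
    obtain h | h := (isIndecomposable_iff.1 hN).2 (algebraMap R (Module.End R N) e)
      (he.map (algebraMap R (Module.End R N)))
    · refine hcon m hm n ?_
      rw [hme, Ideal.submodule_span_eq, Ideal.span_singleton_le_iff_mem, Module.mem_annihilator]
      exact fun x ↦ LinearMap.congr_fun h x
    · have h1 : 1 - e ∈ m := hle (by
        rw [Module.mem_annihilator]
        intro x
        have : e • x = x := LinearMap.congr_fun h x
        rw [sub_smul, one_smul, this, sub_self])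
      have h2 : e ∈ m := Ideal.pow_le_self hn0 (hme ▸ Ideal.mem_span_singleton_self e)
      exact hm.ne_top ((Ideal.eq_top_iff_one m).2 (by simpa using m.add_mem h1 h2))
  obtain ⟨x, hx⟩ := exists_ne (0 : N)
  exact hx (by simpa using Module.mem_annihilator.1 ((Ideal.eq_top_iff_one _).1 htop) x)

end

section

variable {R : Type} [CommRing R] {m : Ideal R}

theorem CompFactor.nonempty_equiv {M : Type} [AddCommGroup M] [Module R M] (hm : m.IsMaximal)
    {n : ℕ} (hM : m ^ n ≤ Module.annihilator R M) (s : CompositionSeries (Submodule R M))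
    (i : Fin s.length) : Nonempty (CompFactor s i ≃ₗ[R] R ⧸ m) := by
  have hstep : s i.castSucc ⋖ s i.succ := s.step i
  have : IsSimpleModule R (CompFactor s i) := (covBy_iff_quot_is_simple hstep.le).1 hstep
  obtain ⟨I, hI, ⟨e⟩⟩ := isSimpleModule_iff_quot_maximal.1 this
  suffices m ≤ I by
    obtain rfl := hm.eq_of_le hI.ne_top this
    exact ⟨e⟩
  refine hI.isPrime.le_of_pow_le (n := n) fun r hr ↦ ?_
  rw [← Ideal.annihilator_quotient (I := I), ← e.annihilator_eq, Module.mem_annihilator]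
  rintro ⟨z⟩
  refine (Submodule.Quotient.mk_eq_zero _).2 ?_
  rw [Submodule.mem_comap]
  convert (s i.castSucc).zero_mem
  exact Module.mem_annihilator.1 (hM hr) _

theorem Ideal.isIndecomposable_quotient (hm : m.IsMaximal) {n : ℕ} {I : Ideal R} (hIm : I ≤ m)
    (hI : m ^ n ≤ I) : IsIndecomposable R (R ⧸ I) := by
  have hne : I ≠ ⊤ := fun h ↦ hm.ne_top (top_le_iff.1 (h ▸ hIm))
  refine ⟨Ideal.Quotient.nontrivial_iff.2 hne, fun A B hAB ↦ ?_⟩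
  have key : ∀ C : Submodule R (R ⧸ I), C ≠ ⊤ → C.comap I.mkQ ≤ m := fun C hC ↦ by
    have hC' : C.comap I.mkQ ≠ ⊤ := fun h ↦ hC (by
      rw [← Submodule.map_comap_eq_of_surjective I.mkQ_surjective C, h, Submodule.map_top,
        Submodule.range_mkQ])
    obtain ⟨m', hm', hle⟩ := Ideal.exists_le_maximal _ hC'
    have : m ≤ m' := hm'.isPrime.le_of_pow_le (n := n) fun r hr ↦ hle (by
      rw [Submodule.mem_comap, Submodule.mkQ_apply, (Submodule.Quotient.mk_eq_zero I).2 (hI hr)]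
      exact C.zero_mem)
    rwa [hm.eq_of_le hm'.ne_top this]
  by_contra! hcon
  have hA : A ≠ ⊤ := fun h ↦ hcon.2 (by simpa [h] using hAB.inf_eq_bot)
  have hB : B ≠ ⊤ := fun h ↦ hcon.1 (by simpa [h] using hAB.inf_eq_bot)
  obtain ⟨a, ha, b, hb, hab⟩ := Submodule.mem_sup.1
    (hAB.sup_eq_top ▸ Submodule.mem_top : I.mkQ 1 ∈ A ⊔ B)
  obtain ⟨a, rfl⟩ := I.mkQ_surjective a
  obtain ⟨b, rfl⟩ := I.mkQ_surjective b
  rw [← map_add] at hab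
  have h1 := hIm ((Submodule.Quotient.eq I).1 hab)
  have h2 := m.sub_mem (m.add_mem (key A hA ha) (key B hB hb)) h1
  exact hm.ne_top ((Ideal.eq_top_iff_one m).2 (by simpa using h2))

theorem Ideal.length_quotient_sq (hm : m.IsMaximal) {x : R} (hx : x ∈ m) (hx' : x ∉ m ^ 2) :
    Module.length R (R ⧸ m ^ 2) =
      Module.length R (R ⧸ m) + Module.length R (R ⧸ (Ideal.span {x} ⊔ m ^ 2)) := by
  refine Module.length_eq_add_of_exact
    (Submodule.mapQ m (m ^ 2) (LinearMap.mulLeft R x) fun r hr ↦ ?_)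
    (Submodule.factor (le_sup_right : m ^ 2 ≤ Ideal.span {x} ⊔ m ^ 2)) ?_ ?_ ?_
  · rw [Submodule.mem_comap, LinearMap.mulLeft_apply, sq]
    exact Ideal.mul_mem_mul hx hr
  · rw [injective_iff_map_eq_zero]
    intro r hr
    obtain ⟨r, rfl⟩ := m.mkQ_surjective r
    rw [Submodule.mkQ_apply, Submodule.mapQ_apply, Submodule.Quotient.mk_eq_zero] at hr
    rw [Submodule.mkQ_apply, Submodule.Quotient.mk_eq_zero]
    by_contra hrm
    obtain ⟨b, c, hc, hbc⟩ := hm.exists_inv hrm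
    refine hx' ?_
    have h1 : b * (x * r) + x * c ∈ m ^ 2 :=
      (m ^ 2).add_mem (Ideal.mul_mem_left _ _ hr) (sq m ▸ Ideal.mul_mem_mul hx hc)
    convert h1 using 1
    linear_combination -x * hbc
  · exact Submodule.factor_surjective _
  · intro r
    obtain ⟨r, rfl⟩ := (m ^ 2 : Ideal R).mkQ_surjective r
    rw [Submodule.factor_mk, Submodule.mkQ_apply, Submodule.Quotient.mk_eq_zero]
    constructor
    · intro hr
      obtain ⟨a, ha, w, hw, rfl⟩ := Submodule.mem_sup.1 hr
      obtain ⟨a, rfl⟩ := Ideal.mem_span_singleton.1 ha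
      refine ⟨m.mkQ a, ?_⟩
      rw [Submodule.mkQ_apply, Submodule.mapQ_apply]
      refine (Submodule.Quotient.eq _).2 ?_
      simpa using hw
    · rintro ⟨a, ha⟩
      obtain ⟨a, rfl⟩ := m.mkQ_surjective a
      have := (Submodule.Quotient.eq _).1 ha
      rw [← neg_sub, neg_mem_iff] at this
      have h2 := (Ideal.span {x} ⊔ m ^ 2).add_mem (Ideal.mem_sup_right this)
        (Ideal.mem_sup_left (Ideal.mul_mem_right a _ (Ideal.mem_span_singleton_self x)))
      simpa using h2

theorem SameCompFactors.of_length_eq {M N : Type} [AddCommGroup M] [Module R M]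
    [AddCommGroup N] [Module R N] (hm : m.IsMaximal) {n : ℕ}
    (hM : m ^ n ≤ Module.annihilator R M) (hN : m ^ n ≤ Module.annihilator R N)
    (hMl : IsFiniteLength R M) (hNl : IsFiniteLength R N)
    (h : Module.length R M = Module.length R N) : SameCompFactors R M N := by
  obtain ⟨s, hs, hs'⟩ := isFiniteLength_iff_exists_compositionSeries.1 hMl
  obtain ⟨t, ht, ht'⟩ := isFiniteLength_iff_exists_compositionSeries.1 hNl
  have hl : s.length = t.length := by
    rw [← Module.length_compositionSeries s hs hs', ← Module.length_compositionSeries t ht ht'] at h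
    exact_mod_cast h
  refine ⟨s, t, hs, hs', ht, ht', finCongr hl, fun i ↦ ?_⟩
  obtain ⟨e⟩ := CompFactor.nonempty_equiv hm hM s i
  obtain ⟨f⟩ := CompFactor.nonempty_equiv hm hN t (finCongr hl i)
  exact ⟨e.trans f.symm⟩

theorem IsArtinianRing.isFiniteLength (R M : Type) [CommRing R] [IsArtinianRing R]
    [AddCommGroup M] [Module R M] [Module.Finite R M] : IsFiniteLength R M :=
  isFiniteLength_iff_isNoetherian_isArtinian.2 ⟨inferInstance, inferInstance⟩

theorem PropertyX.mem_or_mem [IsArtinianRing R] (hR : PropertyX R) (hm : m.IsMaximal) {x y : R}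
    (hx : x ∈ m) (hy : y ∈ m) : x ∈ Ideal.span {y} ⊔ m ^ 2 ∨ y ∈ Ideal.span {x} ⊔ m ^ 2 := by
  by_contra! hcon
  have hx' : x ∉ m ^ 2 := fun h ↦ hcon.1 (Ideal.mem_sup_right h)
  have hy' : y ∉ m ^ 2 := fun h ↦ hcon.2 (Ideal.mem_sup_right h)
  have hle : ∀ z ∈ m, Ideal.span {z} ⊔ m ^ 2 ≤ m := fun z hz ↦
    sup_le ((Ideal.span_singleton_le_iff_mem m).2 hz) (Ideal.pow_le_self two_ne_zero)
  have hfin : ∀ I : Ideal R, IsFiniteLength R (R ⧸ I) := fun _ ↦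
    IsArtinianRing.isFiniteLength R _
  have hlen : Module.length R (R ⧸ (Ideal.span {x} ⊔ m ^ 2)) =
      Module.length R (R ⧸ (Ideal.span {y} ⊔ m ^ 2)) := by
    have h := (Ideal.length_quotient_sq hm hx hx').symm.trans (Ideal.length_quotient_sq hm hy hy')
    exact (ENat.addLECancellable_of_ne_top (Module.length_ne_top_iff.2 (hfin m))).inj.1 h
  obtain ⟨e⟩ := hR _ _ (hfin _) (hfin _)
    (Ideal.isIndecomposable_quotient hm (hle x hx) le_sup_right)
    (Ideal.isIndecomposable_quotient hm (hle y hy) le_sup_right)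
    (SameCompFactors.of_length_eq hm (by rw [Ideal.annihilator_quotient]; exact le_sup_right)
      (by rw [Ideal.annihilator_quotient]; exact le_sup_right) (hfin _) (hfin _) hlen)
  have := e.annihilator_eq
  rw [Ideal.annihilator_quotient, Ideal.annihilator_quotient] at this
  exact hcon.1 (this ▸ Ideal.mem_sup_left (Ideal.mem_span_singleton_self x))

theorem FiniteRepType.of_exists_le_span_sup_sq [IsArtinianRing R]
    (h : ∀ m : Ideal R, m.IsMaximal → ∃ π ∈ m, m ≤ Ideal.span {π} ⊔ m ^ 2) :
    FiniteRepType R := by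
  have hfin : (⋃ m : MaximalSpectrum R,
      {I : Ideal R | ∃ n, m.asIdeal ^ n ≤ I}).Finite := by
    refine Set.finite_iUnion fun m ↦ ?_
    obtain ⟨π, hπ, hm⟩ := h m.asIdeal m.isMaximal
    obtain ⟨n, -, hn⟩ := IsArtinianRing.exists_pow_stable m.asIdeal
    exact (Ideal.finite_setOf_pow_le m.isMaximal hπ hm n).subset
      fun I ⟨k, hk⟩ ↦ (hn k).trans hk
  refine ⟨_, hfin.to_subtype, fun I ↦ R ⧸ I.1, inferInstance, inferInstance,
    fun N _ _ _ hN ↦ ?_⟩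
  obtain ⟨m, hm, n, hn⟩ := hN.exists_pow_le_annihilator
  obtain ⟨π, hπ, hmπ⟩ := h m hm
  obtain ⟨e⟩ := hN.nonempty_equiv_quotient hm hπ hmπ hn
  exact ⟨⟨_, Set.mem_iUnion.2 ⟨⟨m, hm⟩, n, hn⟩⟩, ⟨e.symm⟩⟩

theorem SameCompFactors.eq_of_pow_le_annihilator {M N : Type} [AddCommGroup M] [Module R M]
    [AddCommGroup N] [Module R N] [Nontrivial M] (h : SameCompFactors R M N) {m' : Ideal R}
    (hm : m.IsMaximal) (hm' : m'.IsMaximal) {n n' : ℕ} (hM : m ^ n ≤ Module.annihilator R M)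
    (hN : m' ^ n' ≤ Module.annihilator R N) : m = m' := by
  obtain ⟨s, t, hs, hs', ht, ht', e, he⟩ := h
  have hpos : 0 < s.length := by
    have := Module.length_pos (R := R) (M := M)
    rw [← Module.length_compositionSeries s hs hs'] at this
    exact_mod_cast this
  obtain ⟨f⟩ := he ⟨0, hpos⟩
  obtain ⟨g⟩ := CompFactor.nonempty_equiv hm hM s ⟨0, hpos⟩
  obtain ⟨g'⟩ := CompFactor.nonempty_equiv hm' hN t (e ⟨0, hpos⟩)
  simpa [Ideal.annihilator_quotient] using (g.symm.trans (f.trans g')).annihilator_eq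

theorem SameCompFactors.length_eq {M N : Type} [AddCommGroup M] [Module R M]
    [AddCommGroup N] [Module R N] (h : SameCompFactors R M N) :
    Module.length R M = Module.length R N := by
  obtain ⟨s, t, hs, hs', ht, ht', e, -⟩ := h
  rw [← Module.length_compositionSeries s hs hs', ← Module.length_compositionSeries t ht ht']
  simpa using Fintype.card_congr e

theorem Ideal.eq_of_le_of_length_quotient_eq [IsArtinianRing R] {I J : Ideal R} (hIJ : I ≤ J)
    (h : Module.length R (R ⧸ I) = Module.length R (R ⧸ J)) : I = J := by
  refine le_antisymm hIJ ?_
  have hadd := Module.length_eq_add_of_exact (Submodule.factor hIJ).ker.subtype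
    (Submodule.factor hIJ) (Submodule.subtype_injective _) (Submodule.factor_surjective _)
    (LinearMap.exact_subtype_ker_map _)
  rw [h] at hadd
  have h0 : Module.length R (Submodule.factor hIJ).ker = 0 := by
    have hne : Module.length R (R ⧸ J) ≠ ⊤ := Module.length_ne_top
    exact (ENat.addLECancellable_of_ne_top hne).inj.1 (by rw [add_zero, add_comm]; exact hadd.symm)
  have := Module.length_eq_zero_iff.1 h0
  intro r hr
  have hmem : I.mkQ r ∈ (Submodule.factor hIJ).ker := by
    rw [LinearMap.mem_ker]
    exact (Submodule.Quotient.mk_eq_zero J).2 hr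
  have := Subsingleton.elim (⟨_, hmem⟩ : (Submodule.factor hIJ).ker) 0
  exact (Submodule.Quotient.mk_eq_zero I).1 (congrArg Subtype.val this)

theorem PropertyX.of_exists_le_span_sup_sq [IsArtinianRing R]
    (h : ∀ m : Ideal R, m.IsMaximal → ∃ π ∈ m, m ≤ Ideal.span {π} ⊔ m ^ 2) : PropertyX R := by
  intro M N _ _ _ _ _ _ hM hN hMN
  obtain ⟨m, hm, n, hn⟩ := hM.exists_pow_le_annihilator
  obtain ⟨m', hm', n', hn'⟩ := hN.exists_pow_le_annihilator
  have := hM.1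
  obtain rfl := hMN.eq_of_pow_le_annihilator hm hm' hn hn'
  obtain ⟨π, hπ, hmπ⟩ := h m hm
  obtain ⟨e⟩ := hM.nonempty_equiv_quotient hm hπ hmπ hn
  obtain ⟨f⟩ := hN.nonempty_equiv_quotient hm hπ hmπ hn'
  have hlen := e.length_eq.trans (hMN.length_eq.trans f.length_eq.symm)
  obtain ⟨k, -, hk⟩ := IsArtinianRing.exists_pow_stable m
  have heq : Module.annihilator R M = Module.annihilator R N := by
    obtain hle | hle := Ideal.le_total_of_pow_le hm hπ hmπ ((hk n).trans hn) ((hk n').trans hn')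
    · exact Ideal.eq_of_le_of_length_quotient_eq hle hlen
    · exact (Ideal.eq_of_le_of_length_quotient_eq hle hlen.symm).symm
  exact ⟨e.symm.trans ((Submodule.quotEquivOfEq _ _ heq).trans f)⟩

end

section

open Polynomial

variable {R : Type} [CommRing R] {m : Ideal R} {x y : R}

/-- An algebra `Q` over `R` generated by a nilpotent element `t` with `y = x * t` in `Q` is
indecomposable as an `R`-module if `x • v = 0` forces `v ∈ m • ⊤`. -/
theorem isIndecomposable_of_adjoin_nilpotent {Q : Type} [CommRing Q] [Algebra R Q] [Nontrivial Q]
    (hm : m.IsMaximal) {t : Q} (ht : IsNilpotent t)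
    (hsurj : Function.Surjective (aeval t : R[X] →ₐ[R] Q))
    (hxy : y • (1 : Q) = x • t) (hsq : m ^ 2 • (⊤ : Submodule R Q) = ⊥)
    (hker : ∀ v : Q, x • v = 0 → v ∈ m • (⊤ : Submodule R Q)) :
    IsIndecomposable R Q := by
  refine isIndecomposable_iff.2 ⟨inferInstance, ?_⟩
  set N : Submodule R Q := m • ⊤ with hN_def
  have hmul : ∀ q : Q, ∀ v ∈ N, q * v ∈ N := fun q v hv ↦ by
    rw [hN_def, Ideal.smul_top_eq_map, Submodule.restrictScalars_mem] at hv ⊢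
    exact Ideal.mul_mem_left _ q hv
  have hnil : ∀ r ∈ m, IsNilpotent (algebraMap R Q r) := fun r hr ↦ ⟨2, by
    have : r ^ 2 • (1 : Q) ∈ m ^ 2 • (⊤ : Submodule R Q) :=
      Submodule.smul_mem_smul (Ideal.pow_mem_pow hr 2) trivial
    rwa [hsq, Submodule.mem_bot, ← Algebra.algebraMap_eq_smul_one, map_pow] at this⟩
  have hnil_mul : ∀ q : Q, IsNilpotent (t * q) := fun q ↦ (Commute.all t q).isNilpotent_mul_right ht
  have hlocal : ∀ q : Q, IsUnit q ∨ IsUnit (1 - q) := fun q ↦ by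
    obtain ⟨p, rfl⟩ := hsurj q
    rw [← X_mul_divX_add p, map_add, map_mul, aeval_X, aeval_C]
    by_cases hp : p.coeff 0 ∈ m
    · exact .inr ((Commute.all _ _).isNilpotent_add (hnil_mul _) (hnil _ hp)).isUnit_one_sub
    · obtain ⟨b, c, hc, hbc⟩ := hm.exists_inv hp
      refine .inl (isUnit_of_mul_isUnit_right (x := algebraMap R Q b) ?_)
      have : algebraMap R Q b * (t * aeval t p.divX + algebraMap R Q (p.coeff 0)) =
          1 - (algebraMap R Q c - t * (algebraMap R Q b * aeval t p.divX)) := by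
        rw [← map_one (algebraMap R Q), ← hbc, map_add, map_mul]
        ring
      rw [this]
      exact ((Commute.all _ _).isNilpotent_sub (hnil c hc) (hnil_mul _)).isUnit_one_sub
  have hshift : ∀ (f : Module.End R Q) (v : Q), t * f v - f (t * v) ∈ N := fun f v ↦ by
    refine hker _ ?_
    have hy : ∀ w : Q, x • (t * w) = y • w := fun w ↦ by
      rw [← smul_mul_assoc, ← hxy, smul_mul_assoc, one_mul]
    rw [smul_sub, hy, ← map_smul, ← map_smul, hy, sub_self]
  have hlin : ∀ (f : Module.End R Q) (v : Q), f v - f 1 * v ∈ N := fun f v ↦ by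
    have hstep : ∀ w, f w - f 1 * w ∈ N → f (t * w) - f 1 * (t * w) ∈ N := fun w hw ↦ by
      have := N.sub_mem (hmul t _ hw) (hshift f w)
      convert this using 1
      ring
    obtain ⟨p, rfl⟩ := hsurj v
    induction p using Polynomial.induction_on with
    | C a =>
      rw [aeval_C, Algebra.algebraMap_eq_smul_one, map_smul, mul_smul_comm, mul_one, sub_self]
      exact N.zero_mem
    | add p q hp hq =>
      have := N.add_mem hp hq
      convert this using 1
      rw [map_add, map_add]
      ring
    | monomial k a ih =>
      have : aeval t (C a * X ^ (k + 1)) = t * aeval t (C a * X ^ k) := by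
        simp only [map_mul, map_pow, aeval_X]
        ring
      rw [this]
      exact hstep _ ih
  have hzero : ∀ f : Module.End R Q, IsIdempotentElem f → f 1 ∈ N → f = 0 := fun f hf h1 ↦ by
    have hrange : (⊤ : Submodule R Q).map f ≤ N := by
      rintro _ ⟨v, -, rfl⟩
      have := N.add_mem (hlin f v) (hmul v _ h1)
      convert this using 1
      ring
    have hNbot : N.map f ≤ ⊥ := by
      rw [hN_def, Submodule.map_smul'', ← hsq, sq, mul_smul]
      exact Submodule.smul_mono le_rfl hrange
    ext v
    rw [← hf, Module.End.mul_apply]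
    exact (Submodule.mem_bot R).1 (hNbot ⟨f v, hrange ⟨v, trivial, rfl⟩, rfl⟩)
  intro e he
  have hu : (1 - e 1) * e 1 ∈ N := by
    have := hlin e (e 1)
    rw [show e (e 1) = e 1 from LinearMap.congr_fun he 1] at this
    convert this using 1
    ring
  obtain h | h := hlocal (e 1)
  · right
    have h1 : (1 - e) 1 ∈ N := by
      obtain ⟨b, hb⟩ := h.exists_right_inv
      have := hmul b _ hu
      convert this using 1
      simp only [LinearMap.sub_apply, Module.End.one_apply]
      linear_combination (e 1 - 1) * hb
    exact (sub_eq_zero.1 (hzero _ he.one_sub h1)).symm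
  · left
    refine hzero e he ?_
    obtain ⟨b, hb⟩ := h.exists_right_inv
    have := hmul b _ hu
    convert this using 1
    linear_combination -e 1 * hb

/-- The ideal of `R[X]` generated by `m ^ 2`, `X ^ n` and `y - x * X`. -/
noncomputable def pencilIdeal (m : Ideal R) (x y : R) (n : ℕ) : Ideal R[X] :=
  (m ^ 2).map C ⊔ Ideal.span {X ^ n} ⊔ Ideal.span {C y - C x * X}

theorem exists_coeff_of_mem_pencilIdeal {n : ℕ} {p : R[X]} (hp : p ∈ pencilIdeal m x y n) :
    ∃ c : R[X], ∀ i < n, p.coeff i - (c * (C y - C x * X)).coeff i ∈ m ^ 2 := by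
  obtain ⟨_, hq, b, hb, rfl⟩ := Submodule.mem_sup.1 hp
  obtain ⟨a, ha, b', hb', rfl⟩ := Submodule.mem_sup.1 hq
  obtain ⟨c, rfl⟩ := Ideal.mem_span_singleton'.1 hb
  obtain ⟨d, rfl⟩ := Ideal.mem_span_singleton'.1 hb'
  refine ⟨c, fun i hi ↦ ?_⟩
  rw [coeff_add, coeff_add, coeff_mul_X_pow', if_neg (by omega), add_zero, add_sub_cancel_right]
  exact Ideal.mem_map_C_iff.1 ha i

theorem coeff_mul_pencil_zero (c : R[X]) : (c * (C y - C x * X)).coeff 0 = y * c.coeff 0 := by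
  rw [mul_coeff_zero, coeff_sub, mul_coeff_zero (C x), coeff_X_zero, mul_zero, sub_zero,
    coeff_C_zero, mul_comm]

theorem coeff_mul_pencil_succ (c : R[X]) (i : ℕ) :
    (c * (C y - C x * X)).coeff (i + 1) = y * c.coeff (i + 1) - x * c.coeff i := by
  rw [mul_sub, coeff_sub, coeff_mul_C, ← mul_assoc, coeff_mul_X, coeff_mul_C, mul_comm, mul_comm x]

theorem coeff_mem_of_mem_pencilIdeal (hx : x ∈ m) (hy : y ∈ m) {n : ℕ} {p : R[X]}
    (hp : p ∈ pencilIdeal m x y n) {i : ℕ} (hi : i < n) : p.coeff i ∈ m := by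
  obtain ⟨c, hc⟩ := exists_coeff_of_mem_pencilIdeal hp
  rw [← sub_add_cancel (p.coeff i) ((c * (C y - C x * X)).coeff i)]
  refine m.add_mem (Ideal.pow_le_self two_ne_zero (hc i hi)) ?_
  obtain _ | i := i
  · rw [coeff_mul_pencil_zero]
    exact m.mul_mem_right _ hy
  · rw [coeff_mul_pencil_succ]
    exact m.sub_mem (m.mul_mem_right _ hy) (m.mul_mem_right _ hx)

theorem coeff_mem_of_C_mul_mem_pencilIdeal
    (hxy : ∀ a b, x * a + y * b ∈ m ^ 2 → a ∈ m ∧ b ∈ m) {n : ℕ} {v : R[X]}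
    (hv : C x * v ∈ pencilIdeal m x y n) {i : ℕ} (hi : i < n) : v.coeff i ∈ m := by
  obtain ⟨c, hc⟩ := exists_coeff_of_mem_pencilIdeal hv
  simp only [coeff_C_mul] at hc
  have h0 : ∀ hn : 0 < n, v.coeff 0 ∈ m ∧ c.coeff 0 ∈ m := fun hn ↦ by
    have := hc 0 hn
    rw [coeff_mul_pencil_zero, sub_eq_add_neg, ← mul_neg] at this
    exact (hxy _ _ this).imp_right neg_mem_iff.1
  have hs : ∀ j, j + 1 < n → v.coeff (j + 1) + c.coeff j ∈ m ∧ c.coeff (j + 1) ∈ m := fun j hj ↦ by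
    have := hc (j + 1) hj
    rw [coeff_mul_pencil_succ] at this
    exact (hxy (v.coeff (j + 1) + c.coeff j) (-c.coeff (j + 1))
      (by convert this using 1; ring)).imp_right neg_mem_iff.1
  have hcm : ∀ j < n, c.coeff j ∈ m := fun j hj ↦ by
    obtain _ | j := j
    exacts [(h0 hj).2, (hs j hj).2]
  obtain _ | i := i
  · exact (h0 hi).1
  · exact (Ideal.add_mem_iff_left m (hcm i (by omega))).1 (hs i hi).1

theorem isIndecomposable_quotient_pencilIdeal (hm : m.IsMaximal) (hx : x ∈ m) (hy : y ∈ m)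
    (hxy : ∀ a b, x * a + y * b ∈ m ^ 2 → a ∈ m ∧ b ∈ m) {n : ℕ} (hn : 0 < n) :
    IsIndecomposable R (R[X] ⧸ pencilIdeal m x y n) := by
  set J := pencilIdeal m x y n with hJ
  have hXn : X ^ n ∈ J :=
    Ideal.mem_sup_left (Ideal.mem_sup_right (Ideal.mem_span_singleton_self _))
  have hne : J ≠ ⊤ := fun h ↦ hm.ne_top ((Ideal.eq_top_iff_one m).2 (by
    simpa using coeff_mem_of_mem_pencilIdeal hx hy (h.symm ▸ trivial : (1 : R[X]) ∈ J) hn))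
  have := Ideal.Quotient.nontrivial_iff.2 hne
  have haeval : ∀ p : R[X], aeval (Ideal.Quotient.mk J X) p = Ideal.Quotient.mk J p := fun p ↦ by
    have := aeval_algHom_apply (Ideal.Quotient.mkₐ R J) X p
    rwa [aeval_X_left_apply] at this
  have hsmul : ∀ (r : R) (p : R[X]), r • Ideal.Quotient.mk J p = Ideal.Quotient.mk J (C r * p) :=
    fun r p ↦ by rw [← smul_eq_C_mul]; rfl
  refine isIndecomposable_of_adjoin_nilpotent (x := x) (y := y) hm (t := Ideal.Quotient.mk J X)
    ⟨n, by rw [← map_pow]; exact Ideal.Quotient.eq_zero_iff_mem.2 hXn⟩ (fun q ↦ ?_) ?_ ?_ ?_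
  · obtain ⟨p, rfl⟩ := Ideal.Quotient.mk_surjective q
    exact ⟨p, haeval p⟩
  · rw [← map_one (Ideal.Quotient.mk J), hsmul, hsmul, mul_one, Ideal.Quotient.eq]
    exact Ideal.mem_sup_right (Ideal.mem_span_singleton_self _)
  · refine eq_bot_iff.2 (Submodule.smul_le.2 fun r hr q _ ↦ ?_)
    obtain ⟨p, rfl⟩ := Ideal.Quotient.mk_surjective q
    rw [hsmul, Submodule.mem_bot, Ideal.Quotient.eq_zero_iff_mem]
    exact Ideal.mul_mem_right _ _ (Ideal.mem_sup_left (Ideal.mem_sup_left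
      (Ideal.mem_map_of_mem C hr)))
  · intro q hq
    obtain ⟨p, rfl⟩ := Ideal.Quotient.mk_surjective q
    rw [hsmul, Ideal.Quotient.eq_zero_iff_mem] at hq
    rw [p.as_sum_range_C_mul_X_pow, map_sum]
    refine Submodule.sum_mem _ fun i _ ↦ ?_
    rw [← hsmul]
    by_cases hi : i < n
    · exact Submodule.smul_mem_smul (coeff_mem_of_C_mul_mem_pencilIdeal hxy hq hi) trivial
    · rw [Ideal.Quotient.eq_zero_iff_mem.2 (Ideal.mem_of_dvd J (pow_dvd_pow X (not_lt.1 hi)) hXn),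
        smul_zero]
      exact Submodule.zero_mem _

theorem finite_quotient_pencilIdeal (m : Ideal R) (x y : R) (n : ℕ) :
    Module.Finite R (R[X] ⧸ pencilIdeal m x y n) := by
  have := (monic_X_pow (R := R) n).finite_quotient
  have hle : Ideal.span {X ^ n} ≤ pencilIdeal m x y n := le_sup_right.trans le_sup_left
  exact Module.Finite.of_surjective (Ideal.Quotient.factorₐ R hle).toLinearMap
    (Ideal.Quotient.factor_surjective hle)

theorem le_of_surjective_quotient_pencilIdeal (hm : m.IsMaximal) (hx : x ∈ m) (hy : y ∈ m)
    {n d : ℕ} (f : (Fin d → R) →ₗ[R] R[X] ⧸ pencilIdeal m x y n) (hf : Function.Surjective f) :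
    n ≤ d := by
  let g : R[X] →ₗ[R] (Fin n → R ⧸ m) := LinearMap.pi fun i ↦ m.mkQ ∘ₗ lcoeff R i
  have hg : Function.Surjective g := fun w ↦ by
    choose a ha using fun i ↦ m.mkQ_surjective (w i)
    refine ⟨∑ i : Fin n, C (a i) * X ^ (i : ℕ), funext fun i ↦ ?_⟩
    rw [← ha]
    simp [g, coeff_X_pow, Fin.val_inj, apply_ite]
  let h : (R[X] ⧸ pencilIdeal m x y n) →ₗ[R] (Fin n → R ⧸ m) :=
    ((pencilIdeal m x y n).restrictScalars R).liftQ g fun p hp ↦ funext fun i ↦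
      (Submodule.Quotient.mk_eq_zero m).2 (coeff_mem_of_mem_pencilIdeal hx hy hp i.2)
  have hh : Function.Surjective h := fun w ↦ by
    obtain ⟨p, hp⟩ := hg w
    exact ⟨Ideal.Quotient.mk _ p, hp⟩
  let _ := Ideal.Quotient.field m
  have hspan : ⊤ ≤ Submodule.span (R ⧸ m) (Set.range fun j : Fin d ↦ h (f (Pi.single j 1))) := by
    intro w _
    obtain ⟨z, rfl⟩ := hh w
    obtain ⟨a, rfl⟩ := hf z
    rw [pi_eq_sum_univ' a, map_sum, map_sum]
    refine Submodule.sum_mem _ fun j _ ↦ ?_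
    have := Submodule.smul_mem _ (Ideal.Quotient.mk m (a j))
      (Submodule.subset_span (R := R ⧸ m) (Set.mem_range_self (f := fun j : Fin d ↦
        h (f (Pi.single j 1))) j))
    convert this using 1
    rw [map_smul, map_smul]
    rfl
  have := finrank_le_of_span_eq_top (top_le_iff.1 hspan)
  simpa using this

end

/-- The numbers of generators of finitely generated indecomposable modules over a ring of finite
representation type are bounded. -/
theorem FiniteRepType.exists_surjective {R : Type} [CommRing R] (hR : FiniteRepType R) :
    ∃ d, ∀ (N : Type) [AddCommGroup N] [Module R N], Module.Finite R N → IsIndecomposable R N →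
      ∃ e ≤ d, ∃ f : (Fin e → R) →ₗ[R] N, Function.Surjective f := by
  classical
  obtain ⟨ι, _, M, _, _, hM⟩ := hR
  have hgen : ∀ i, ∃ k, Module.Finite R (M i) →
      ∃ f : (Fin k → R) →ₗ[R] M i, Function.Surjective f := fun i ↦ by
    by_cases h : Module.Finite R (M i)
    · obtain ⟨k, f, hf⟩ := Module.Finite.exists_fin' R (M i)
      exact ⟨k, fun _ ↦ ⟨f, hf⟩⟩
    · exact ⟨0, fun h' ↦ absurd h' h⟩
  choose k hk using hgen
  obtain ⟨d, hd⟩ := Finite.bddAbove_range k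
  refine ⟨d, fun N _ _ hfin hN ↦ ?_⟩
  obtain ⟨i, ⟨e⟩⟩ := hM N _ _ hfin hN
  obtain ⟨f, hf⟩ := hk i (Module.Finite.equiv e)
  exact ⟨k i, hd ⟨i, rfl⟩, e.symm.toLinearMap ∘ₗ f, e.symm.surjective.comp hf⟩

theorem FiniteRepType.mem_or_mem {R : Type} [CommRing R] (hR : FiniteRepType R) {m : Ideal R}
    (hm : m.IsMaximal) {x y : R} (hx : x ∈ m) (hy : y ∈ m) :
    x ∈ Ideal.span {y} ⊔ m ^ 2 ∨ y ∈ Ideal.span {x} ⊔ m ^ 2 := by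
  by_contra! hcon
  have hxy : ∀ x ∈ m, ∀ y, x ∉ Ideal.span {y} ⊔ m ^ 2 →
      ∀ a b, x * a + y * b ∈ m ^ 2 → a ∈ m := fun x hx y hxy a b hab ↦ by
    by_contra ha
    obtain ⟨a', c, hc, hac⟩ := hm.exists_inv ha
    refine hxy ?_
    have h1 : a' * (x * a + y * b) + x * c ∈ m ^ 2 :=
      (m ^ 2).add_mem (Ideal.mul_mem_left _ _ hab) (sq m ▸ Ideal.mul_mem_mul hx hc)
    have h2 := (Ideal.span {y} ⊔ m ^ 2).sub_mem (Ideal.mem_sup_right h1)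
      (Ideal.mem_sup_left (Ideal.mul_mem_right (a' * b) _ (Ideal.mem_span_singleton_self y)))
    convert h2 using 1
    linear_combination -x * hac
  have hind : ∀ a b, x * a + y * b ∈ m ^ 2 → a ∈ m ∧ b ∈ m := fun a b hab ↦
    ⟨hxy x hx y hcon.1 a b hab, hxy y hy x hcon.2 b a (by rwa [add_comm])⟩
  obtain ⟨d, hd⟩ := hR.exists_surjective
  obtain ⟨e, he, f, hf⟩ := hd _ (finite_quotient_pencilIdeal m x y (d + 1))
    (isIndecomposable_quotient_pencilIdeal hm hx hy hind d.succ_pos)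
  have := le_of_surjective_quotient_pencilIdeal hm hx hy f hf
  omega

/-- a commutative artinian ring satisfies 𝔛 iff it is of finite
representation type. -/
theorem stmt_5 (R : Type) [CommRing R] [IsArtinianRing R] :
    PropertyX R ↔ FiniteRepType R :=
  ⟨fun h ↦ .of_exists_le_span_sup_sq fun _ hm ↦
    Ideal.exists_le_span_sup_sq fun _ hx _ hy ↦ h.mem_or_mem hm hx hy,
  fun h ↦ .of_exists_le_span_sup_sq fun _ hm ↦
    Ideal.exists_le_span_sup_sq fun _ hx _ hy ↦ h.mem_or_mem hm hx hy⟩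
end

section
/- The free algebra F⟨X,Y⟩ over a field F does not satisfy property 𝔛: the quotient A = F⟨X,Y⟩/(X², Y², XY − YX) is a commutative artinian local ring that is not a principal ideal ring, and hence admits two non-isomorphic finite length indecomposable modules with the same composition factors. -/
open Submodule

/-- The relations `X² = 0`, `Y² = 0`, `XY = YX` on the free algebra `F⟨X,Y⟩`. -/
inductive FreeRel (F : Type) [Field F] :
    FreeAlgebra F (Fin 2) → FreeAlgebra F (Fin 2) → Prop
  | Xsq : FreeRel F (FreeAlgebra.ι F 0 * FreeAlgebra.ι F 0) 0
  | Ysq : FreeRel F (FreeAlgebra.ι F 1 * FreeAlgebra.ι F 1) 0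
  | comm : FreeRel F (FreeAlgebra.ι F 0 * FreeAlgebra.ι F 1)
      (FreeAlgebra.ι F 1 * FreeAlgebra.ι F 0)

section ShortExact

variable {R M T : Type} [Ring R] [AddCommGroup M] [Module R M] [AddCommGroup T] [Module R T]

/-- A self-extension of a simple module `T` has a composition series of length two
whose factors are isomorphic to `T`. -/
theorem exists_compositionSeries_of_exact [IsSimpleModule R T] (j : T →ₗ[R] M) (p : M →ₗ[R] T)
    (hj : Function.Injective j) (hp : Function.Surjective p)
    (hjp : LinearMap.range j = LinearMap.ker p) :
    ∃ s : CompositionSeries (Submodule R M), s.head = ⊥ ∧ s.last = ⊤ ∧ s.length = 2 ∧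
      ∀ i, Nonempty (CompFactor s i ≃ₗ[R] T) := by
  have e₀ : Nonempty ((↥(LinearMap.ker p) ⧸ comap (LinearMap.ker p).subtype ⊥) ≃ₗ[R] T) := by
    rw [← hjp]
    refine ⟨(quotEquivOfEqBot _ ?_).trans (LinearEquiv.ofInjective j hj).symm⟩
    rw [← LinearMap.ker, Submodule.ker_subtype]
  have e₁ : Nonempty ((↥(⊤ : Submodule R M) ⧸ comap (⊤ : Submodule R M).subtype (LinearMap.ker p))
      ≃ₗ[R] T) := by
    refine ⟨(quotEquivOfEq _ _ ?_).trans
      ((p.comp (⊤ : Submodule R M).subtype).quotKerEquivOfSurjective ?_)⟩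
    · rw [LinearMap.ker_comp]
    · intro t
      obtain ⟨m, rfl⟩ := hp t
      exact ⟨⟨m, trivial⟩, rfl⟩
  have c₀ : (⊥ : Submodule R M) ⋖ LinearMap.ker p :=
    (covBy_iff_quot_is_simple bot_le).2 (IsSimpleModule.congr e₀.some)
  have c₁ : LinearMap.ker p ⋖ (⊤ : Submodule R M) :=
    (covBy_iff_quot_is_simple le_top).2 (IsSimpleModule.congr e₁.some)
  have step : ∀ i : Fin 2, (![⊥, LinearMap.ker p, ⊤] : Fin 3 → Submodule R M) i.castSucc ⋖
      (![⊥, LinearMap.ker p, ⊤] : Fin 3 → Submodule R M) i.succ := by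
    intro i
    fin_cases i
    · exact c₀
    · exact c₁
  refine ⟨⟨2, ![⊥, LinearMap.ker p, ⊤], step⟩, rfl, rfl, rfl, fun i => ?_⟩
  fin_cases i
  · exact e₀
  · exact e₁

end ShortExact

section DualModule

open scoped DualNumber

variable (F : Type) [Field F]

/-- The augmentation `F⟨X,Y⟩ → F` killing `X` and `Y`. -/
def freeAug : FreeAlgebra F (Fin 2) →ₐ[F] F := FreeAlgebra.lift F fun _ => 0

/-- The map `F⟨X,Y⟩ → F[ε]` sending the `i`-th variable to `c i • ε`. -/
def freeToDual (c : Fin 2 → F) : FreeAlgebra F (Fin 2) →ₐ[F] F[ε] :=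
  FreeAlgebra.lift F fun i => c i • ε

@[simp]
theorem freeAug_ι (i : Fin 2) : freeAug F (FreeAlgebra.ι F i) = 0 := by
  simp [freeAug]

@[simp]
theorem freeToDual_ι (c : Fin 2 → F) (i : Fin 2) :
    freeToDual F c (FreeAlgebra.ι F i) = c i • ε := by
  simp [freeToDual]

theorem fst_freeToDual (c : Fin 2 → F) (a : FreeAlgebra F (Fin 2)) :
    (freeToDual F c a).fst = freeAug F a := by
  have h : (TrivSqZeroExt.fstHom F F F).comp (freeToDual F c) = freeAug F := by
    ext i
    simp
  exact DFunLike.congr_fun h a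

/-- The one-dimensional module on which `X` and `Y` act as zero. -/
def TrivialModule : Type := F

/-- The two-dimensional module `F[ε]` on which the `i`-th variable acts as `c i • ε`. -/
def DualModule (_c : Fin 2 → F) : Type := F[ε]

instance : AddCommGroup (TrivialModule F) := inferInstanceAs (AddCommGroup F)

instance : Nontrivial (TrivialModule F) := inferInstanceAs (Nontrivial F)

noncomputable instance : Module (FreeAlgebra F (Fin 2)) (TrivialModule F) :=
  Module.compHom F (freeAug F).toRingHom

instance (c : Fin 2 → F) : AddCommGroup (DualModule F c) := inferInstanceAs (AddCommGroup F[ε])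

instance (c : Fin 2 → F) : Nontrivial (DualModule F c) := inferInstanceAs (Nontrivial F[ε])

noncomputable instance (c : Fin 2 → F) : Module (FreeAlgebra F (Fin 2)) (DualModule F c) :=
  Module.compHom F[ε] (freeToDual F c).toRingHom

variable {F}

/-- The identification of `F` with the trivial module. -/
def TrivialModule.of : F ≃+ TrivialModule F := AddEquiv.refl F

/-- The identification of `F[ε]` with the module `DualModule F c`. -/
def DualModule.of (c : Fin 2 → F) : F[ε] ≃+ DualModule F c := AddEquiv.refl F[ε]

theorem TrivialModule.smul_of (a : FreeAlgebra F (Fin 2)) (t : F) :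
    a • TrivialModule.of t = TrivialModule.of (freeAug F a * t) := rfl

theorem DualModule.smul_of (c : Fin 2 → F) (a : FreeAlgebra F (Fin 2)) (m : F[ε]) :
    a • DualModule.of c m = DualModule.of c (freeToDual F c a * m) := rfl

instance : IsSimpleModule (FreeAlgebra F (Fin 2)) (TrivialModule F) := by
  refine isSimpleModule_iff_toSpanSingleton_surjective.2 ⟨inferInstance, fun t ht s => ?_⟩
  obtain ⟨t, rfl⟩ := TrivialModule.of.surjective t
  obtain ⟨s, rfl⟩ := TrivialModule.of.surjective s
  refine ⟨algebraMap F _ (s / t), ?_⟩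
  have ht' : t ≠ 0 := fun h => ht (by rw [h, map_zero])
  rw [LinearMap.toSpanSingleton_apply, TrivialModule.smul_of, AlgHom.commutes]
  simp [ht']

/-- The inclusion of the socle `F ε` of `F[ε]`. -/
def DualModule.inr (c : Fin 2 → F) :
    TrivialModule F →ₗ[FreeAlgebra F (Fin 2)] DualModule F c where
  toFun t := DualModule.of c (TrivSqZeroExt.inr (TrivialModule.of.symm t))
  map_add' x y := by rw [map_add, TrivSqZeroExt.inr_add, map_add]
  map_smul' a x := by
    obtain ⟨x, rfl⟩ := TrivialModule.of.surjective x
    rw [TrivialModule.smul_of, RingHom.id_apply, DualModule.smul_of]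
    congr 1
    ext <;> simp [fst_freeToDual, mul_comm]

/-- The projection of `F[ε]` onto `F[ε] / F ε`. -/
def DualModule.fst (c : Fin 2 → F) :
    DualModule F c →ₗ[FreeAlgebra F (Fin 2)] TrivialModule F where
  toFun m := TrivialModule.of ((DualModule.of c).symm m).fst
  map_add' x y := by simp
  map_smul' a x := by
    obtain ⟨x, rfl⟩ := (DualModule.of c).surjective x
    rw [DualModule.smul_of, RingHom.id_apply, TrivialModule.smul_of]
    simp [fst_freeToDual]

theorem DualModule.exists_compositionSeries (c : Fin 2 → F) :
    ∃ s : CompositionSeries (Submodule (FreeAlgebra F (Fin 2)) (DualModule F c)),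
      s.head = ⊥ ∧ s.last = ⊤ ∧ s.length = 2 ∧
      ∀ i, Nonempty (CompFactor s i ≃ₗ[FreeAlgebra F (Fin 2)] TrivialModule F) := by
  refine exists_compositionSeries_of_exact (DualModule.inr c) (DualModule.fst c) ?_ ?_ ?_
  · exact (DualModule.of c).injective.comp
      (TrivSqZeroExt.inr_injective.comp TrivialModule.of.symm.injective)
  · exact TrivialModule.of.surjective.comp
      (TrivSqZeroExt.fst_surjective.comp (DualModule.of c).symm.surjective)
  · ext m
    constructor
    · rintro ⟨t, rfl⟩
      rfl
    · intro hm
      exact ⟨TrivialModule.of ((DualModule.of c).symm m).snd, TrivSqZeroExt.ext (Eq.symm hm) rfl⟩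

theorem DualModule.isFiniteLength (c : Fin 2 → F) :
    IsFiniteLength (FreeAlgebra F (Fin 2)) (DualModule F c) := by
  obtain ⟨s, h₀, h₁, -⟩ := DualModule.exists_compositionSeries c
  exact isFiniteLength_iff_exists_compositionSeries.2 ⟨s, h₀, h₁⟩

theorem DualModule.sameCompFactors (c d : Fin 2 → F) :
    SameCompFactors (FreeAlgebra F (Fin 2)) (DualModule F c) (DualModule F d) := by
  obtain ⟨s, hs₀, hs₁, hs, es⟩ := DualModule.exists_compositionSeries c
  obtain ⟨t, ht₀, ht₁, ht, et⟩ := DualModule.exists_compositionSeries d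
  exact ⟨s, t, hs₀, hs₁, ht₀, ht₁, finCongr (hs.trans ht.symm),
    fun i => ⟨(es i).some.trans (et _).some.symm⟩⟩

theorem DualModule.eps_mem {c : Fin 2 → F} (hc : c ≠ 0)
    {A : Submodule (FreeAlgebra F (Fin 2)) (DualModule F c)} (hA : A ≠ ⊥) :
    DualModule.of c ε ∈ A := by
  obtain ⟨m, hm, hm0⟩ := A.exists_mem_ne_zero_of_ne_bot hA
  obtain ⟨m, rfl⟩ := (DualModule.of c).surjective m
  obtain ⟨i, hi⟩ := Function.ne_iff.1 hc
  change c i ≠ 0 at hi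
  suffices ∃ a : FreeAlgebra F (Fin 2), freeToDual F c a * m = ε by
    obtain ⟨a, ha⟩ := this
    rw [← ha, ← DualModule.smul_of]
    exact A.smul_mem a hm
  by_cases hu : m.fst = 0
  · have hv : m.snd ≠ 0 := fun hv =>
      hm0 (by rw [show m = 0 from TrivSqZeroExt.ext hu hv, map_zero])
    refine ⟨algebraMap F _ m.snd⁻¹, ?_⟩
    rw [AlgHom.commutes]
    ext <;> simp [hu, hv, TrivSqZeroExt.algebraMap_eq_inl]
  · refine ⟨algebraMap F _ (c i * m.fst)⁻¹ * FreeAlgebra.ι F i, ?_⟩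
    rw [map_mul, AlgHom.commutes, freeToDual_ι]
    ext
    · simp [TrivSqZeroExt.algebraMap_eq_inl]
    · simp [TrivSqZeroExt.algebraMap_eq_inl]
      field_simp

theorem DualModule.isIndecomposable {c : Fin 2 → F} (hc : c ≠ 0) :
    IsIndecomposable (FreeAlgebra F (Fin 2)) (DualModule F c) := by
  refine ⟨inferInstance, fun A B hAB => ?_⟩
  by_contra! h
  have h0 := (disjoint_def.1 hAB.disjoint) _ (eps_mem hc h.1) (eps_mem hc h.2)
  rw [map_eq_zero_iff _ (DualModule.of c).injective] at h0
  simpa using congrArg TrivSqZeroExt.snd h0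

theorem DualModule.apply_eq_zero_of_equiv {c d : Fin 2 → F}
    (e : DualModule F c ≃ₗ[FreeAlgebra F (Fin 2)] DualModule F d) {i : Fin 2} (hi : d i = 0) :
    c i = 0 := by
  have h : FreeAlgebra.ι F i • DualModule.of c 1 = 0 := by
    apply e.injective
    obtain ⟨z, hz⟩ := (DualModule.of d).surjective (e (DualModule.of c 1))
    rw [map_smul, map_zero, ← hz, DualModule.smul_of, freeToDual_ι, hi, zero_smul, zero_mul,
      map_zero]
  rw [DualModule.smul_of, freeToDual_ι, map_eq_zero_iff _ (DualModule.of c).injective] at h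
  simpa using congrArg TrivSqZeroExt.snd h

theorem not_propertyX_freeAlgebra (F : Type) [Field F] :
    ¬ PropertyX (FreeAlgebra F (Fin 2)) := by
  intro h
  have hc : (![1, 0] : Fin 2 → F) ≠ 0 := fun h => one_ne_zero (congrFun h 0)
  have hd : (![0, 1] : Fin 2 → F) ≠ 0 := fun h => one_ne_zero (congrFun h 1)
  obtain ⟨e⟩ := h _ _ (DualModule.isFiniteLength _) (DualModule.isFiniteLength _)
    (DualModule.isIndecomposable hc) (DualModule.isIndecomposable hd)
    (DualModule.sameCompFactors _ _)
  exact one_ne_zero (DualModule.apply_eq_zero_of_equiv e (i := 0) rfl)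

namespace FreeRel

variable (F) in
/-- The quotient map `F⟨X,Y⟩ → A`. -/
noncomputable abbrev mk : FreeAlgebra F (Fin 2) →ₐ[F] RingQuot (FreeRel F) :=
  RingQuot.mkAlgHom F (FreeRel F)

variable (F) in
/-- The class of the `i`-th variable in `A`. -/
noncomputable abbrev gen (i : Fin 2) : RingQuot (FreeRel F) := mk F (FreeAlgebra.ι F i)

theorem gen_mul_self (i : Fin 2) : gen F i * gen F i = 0 := by
  rw [← map_mul, ← map_zero (mk F)]
  fin_cases i
  · exact RingQuot.mkAlgHom_rel F Xsq
  · exact RingQuot.mkAlgHom_rel F Ysq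

theorem gen_comm (i j : Fin 2) : Commute (gen F i) (gen F j) := by
  have h : gen F 0 * gen F 1 = gen F 1 * gen F 0 := by
    rw [← map_mul, ← map_mul]
    exact RingQuot.mkAlgHom_rel F comm
  fin_cases i <;> fin_cases j
  · rfl
  · exact h
  · exact h.symm
  · rfl

theorem mul_comm (a b : RingQuot (FreeRel F)) : a * b = b * a := by
  obtain ⟨a, rfl⟩ := RingQuot.mkAlgHom_surjective F (FreeRel F) a
  obtain ⟨b, rfl⟩ := RingQuot.mkAlgHom_surjective F (FreeRel F) b
  change Commute (mk F a) (mk F b)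
  induction a using FreeAlgebra.induction with
  | grade0 r => rw [AlgHom.commutes]; exact Algebra.commutes r _
  | mul x y hx hy => rw [map_mul]; exact hx.mul_left hy
  | add x y hx hy => rw [map_add]; exact hx.add_left hy
  | grade1 i =>
    induction b using FreeAlgebra.induction with
    | grade0 r => rw [AlgHom.commutes]; exact (Algebra.commutes r _).symm
    | mul x y hx hy => rw [map_mul]; exact hx.mul_right hy
    | add x y hx hy => rw [map_add]; exact hx.add_right hy
    | grade1 j => exact gen_comm i j

theorem mk_mul_mem_span (a : FreeAlgebra F (Fin 2)) (s : RingQuot (FreeRel F))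
    (hs : s ∈ span F {1, gen F 0, gen F 1, gen F 0 * gen F 1}) :
    mk F a * s ∈ span F {1, gen F 0, gen F 1, gen F 0 * gen F 1} := by
  induction a using FreeAlgebra.induction generalizing s with
  | grade0 r => rw [AlgHom.commutes, ← Algebra.smul_def]; exact smul_mem _ r hs
  | mul x y hx hy => rw [map_mul, mul_assoc]; exact hx _ (hy _ hs)
  | add x y hx hy => rw [map_add, add_mul]; exact add_mem (hx _ hs) (hy _ hs)
  | grade1 i =>
    change gen F i * s ∈ _
    have hx := gen_mul_self (F := F) 0
    have hy := gen_mul_self (F := F) 1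
    have hxy := mul_comm (gen F 1) (gen F 0)
    have hsub := subset_span (R := F) (s := {1, gen F 0, gen F 1, gen F 0 * gen F 1})
    induction hs using span_induction with
    | zero => rw [mul_zero]; exact zero_mem _
    | add x y _ _ hx hy => rw [mul_add]; exact add_mem hx hy
    | smul r x _ hx => rw [mul_smul_comm]; exact smul_mem _ r hx
    | mem z hz =>
      rcases hz with rfl | rfl | rfl | rfl <;> fin_cases i <;>
        simp only [Fin.zero_eta, Fin.mk_one, mul_one, hx, hy, hxy, ← mul_assoc, zero_mul] <;>
        first
          | exact zero_mem _
          | (rw [mul_assoc, hy, mul_zero]; exact zero_mem _)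
          | exact hsub (by simp)

instance : Module.Finite F (RingQuot (FreeRel F)) := by
  refine ⟨fg_def.2 ⟨{1, gen F 0, gen F 1, gen F 0 * gen F 1}, Set.toFinite _, ?_⟩⟩
  rw [eq_top_iff]
  rintro a -
  obtain ⟨a, rfl⟩ := RingQuot.mkAlgHom_surjective F (FreeRel F) a
  simpa using mk_mul_mem_span a 1 (subset_span (by simp))

/-- The map `A → F[ε]` sending the `i`-th variable to `c i • ε`. -/
noncomputable def toDual (c : Fin 2 → F) : RingQuot (FreeRel F) →ₐ[F] F[ε] :=
  RingQuot.liftAlgHom F ⟨freeToDual F c, by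
    intro x y h
    cases h <;> simp⟩

theorem toDual_mk (c : Fin 2 → F) (a : FreeAlgebra F (Fin 2)) :
    toDual c (mk F a) = freeToDual F c a :=
  RingQuot.liftAlgHom_mkAlgHom_apply _ _ _ _

theorem isNilpotent_mk_sub (a : FreeAlgebra F (Fin 2)) :
    IsNilpotent (mk F a - algebraMap F _ (freeAug F a)) := by
  induction a using FreeAlgebra.induction with
  | grade0 r => simp
  | grade1 i => exact ⟨2, by
    rw [freeAug_ι, map_zero, sub_zero, sq]
    exact gen_mul_self i⟩
  | add x y hx hy =>
    have := Commute.isNilpotent_add (mul_comm _ _) hx hy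
    simpa [add_sub_add_comm] using this
  | mul x y hx hy =>
    have h₁ := Commute.isNilpotent_mul_right (mul_comm _ (mk F y)) hx
    have h₂ := Commute.isNilpotent_mul_left (mul_comm (algebraMap F _ (freeAug F x)) _) hy
    have := Commute.isNilpotent_add (mul_comm _ _) h₁ h₂
    simpa [sub_mul, mul_sub] using this

theorem isUnit_mk {a : FreeAlgebra F (Fin 2)} (ha : freeAug F a ≠ 0) : IsUnit (mk F a) := by
  have hu : IsUnit (algebraMap F (RingQuot (FreeRel F)) (freeAug F a)) :=
    (IsUnit.mk0 _ ha).map (algebraMap F _)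
  simpa using (isNilpotent_mk_sub a).isUnit_add_left_of_commute hu (mul_comm _ _)

instance : Nontrivial (RingQuot (FreeRel F)) := (toDual (0 : Fin 2 → F)).toRingHom.domain_nontrivial

instance : IsLocalRing (RingQuot (FreeRel F)) where
  isUnit_or_isUnit_of_add_one {a b} hab := by
    obtain ⟨a, rfl⟩ := RingQuot.mkAlgHom_surjective F (FreeRel F) a
    obtain ⟨b, rfl⟩ := RingQuot.mkAlgHom_surjective F (FreeRel F) b
    by_cases ha : freeAug F a = 0
    · refine .inr (isUnit_mk fun hb => ?_)
      have h := congrArg (fun z => (toDual (0 : Fin 2 → F) z).fst) hab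
      simp [toDual_mk, fst_freeToDual, ha, hb] at h
    · exact .inl (isUnit_mk ha)

theorem not_isPrincipalIdealRing : ¬ IsPrincipalIdealRing (RingQuot (FreeRel F)) := by
  intro h
  obtain ⟨g, hg⟩ := (h.principal (Ideal.span {gen F 0, gen F 1})).principal
  have hx : gen F 0 ∈ span (RingQuot (FreeRel F)) {g} := hg ▸ Ideal.subset_span (by simp)
  have hy : gen F 1 ∈ span (RingQuot (FreeRel F)) {g} := hg ▸ Ideal.subset_span (by simp)
  have hg' : g ∈ Ideal.span {gen F 0, gen F 1} := hg ▸ mem_span_singleton_self g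
  obtain ⟨a, ha⟩ := mem_span_singleton.1 hx
  obtain ⟨b, hb⟩ := mem_span_singleton.1 hy
  obtain ⟨p, q, hpq⟩ := Ideal.mem_span_pair.1 hg'
  obtain ⟨a, rfl⟩ := RingQuot.mkAlgHom_surjective F (FreeRel F) a
  obtain ⟨b, rfl⟩ := RingQuot.mkAlgHom_surjective F (FreeRel F) b
  have key (c : Fin 2 → F) : ∃ w : F, freeAug F a * w = c 0 ∧ freeAug F b * w = c 1 := by
    have hg0 : (toDual c g).fst = 0 := by
      simp [← hpq, toDual_mk]
    refine ⟨(toDual c g).snd, ?_, ?_⟩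
    · simpa [toDual_mk, fst_freeToDual, hg0] using congrArg (fun z => (toDual c z).snd) ha
    · simpa [toDual_mk, fst_freeToDual, hg0] using congrArg (fun z => (toDual c z).snd) hb
  obtain ⟨u, hu₀, hu₁⟩ := key ![1, 0]
  obtain ⟨v, hv₀, hv₁⟩ := key ![0, 1]
  simp only [Matrix.cons_val_zero, Matrix.cons_val_one] at hu₀ hu₁ hv₀ hv₁
  have : (1 : F) = 0 := by
    linear_combination -hu₀ * freeAug F b * v + freeAug F a * v * hu₁ - hv₁
  exact one_ne_zero this

end FreeRel

end DualModule

/-- `A = F⟨X,Y⟩/(X², Y², XY − YX)` is a commutative artinian local ring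
which is not a principal ideal ring, and the free algebra `F⟨X,Y⟩` does not satisfy
property 𝔛. -/
theorem stmt_15 (F : Type) [Field F] :
    (∀ a b : RingQuot (FreeRel F), a * b = b * a) ∧
    IsArtinianRing (RingQuot (FreeRel F)) ∧
    IsLocalRing (RingQuot (FreeRel F)) ∧
    ¬ IsPrincipalIdealRing (RingQuot (FreeRel F)) ∧
    ¬ PropertyX (FreeAlgebra F (Fin 2)) := by
  exact ⟨FreeRel.mul_comm, isArtinian_of_tower F inferInstance, inferInstance,
    FreeRel.not_isPrincipalIdealRing, not_propertyX_freeAlgebra F⟩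
end

section
/- Let Λ be an Artin algebra with Jacobson radical J satisfying J² = 0, and let Γ be the triangular matrix algebra [[Λ/J, J],[0, Λ/J]]. If Λ satisfies property 𝔛, then Γ satisfies property 𝔛. -/
open Submodule

section TriangularMatrixAlgebra

variable (A M' : Type) [Ring A] [AddCommGroup M'] [Module A M'] [Module Aᵐᵒᵖ M']
  [SMulCommClass A Aᵐᵒᵖ M']

/-- `M'` as a left module over `A × A` via the first coordinate. -/
instance instLeftProd : Module (A × A) M' := Module.compHom M' (RingHom.fst A A)

/-- `M'` as a right module over `A × A` via the second coordinate. -/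
instance instRightProd : Module (A × A)ᵐᵒᵖ M' :=
  Module.compHom M' (RingHom.op (RingHom.snd A A))

instance instSMulCommProd : SMulCommClass (A × A) (A × A)ᵐᵒᵖ M' :=
  ⟨fun r s m => smul_comm ((RingHom.fst A A) r) ((RingHom.op (RingHom.snd A A)) s) m⟩

/-- The triangular matrix algebra `[[A, M'], [0, A]]`, realized as the trivial square-zero
extension of `A × A` by `M'` with left action through the first coordinate and right
action through the second coordinate. -/
abbrev TriangularAlg := TrivSqZeroExt (A × A) M'

end TriangularMatrixAlgebra

/-- Two intervals `a ≤ b` and `c ≤ d` of submodules have isomorphic quotients. -/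
def QuotIso (R : Type) [Ring R] {M N : Type} [AddCommGroup M] [Module R M]
    [AddCommGroup N] [Module R N] (a b : Submodule R M) (c d : Submodule R N) : Prop :=
  Nonempty ((↥b ⧸ Submodule.comap b.subtype a) ≃ₗ[R] (↥d ⧸ Submodule.comap d.subtype c))

namespace QuotIso

variable {R : Type} [Ring R] {M N P : Type} [AddCommGroup M] [Module R M]
    [AddCommGroup N] [Module R N] [AddCommGroup P] [Module R P]

theorem symm {a b : Submodule R M} {c d : Submodule R N} (h : QuotIso R a b c d) :
    QuotIso R c d a b :=
  h.map LinearEquiv.symm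

theorem trans {a b : Submodule R M} {c d : Submodule R N} {e f : Submodule R P}
    (h : QuotIso R a b c d) (h' : QuotIso R c d e f) : QuotIso R a b e f :=
  ⟨h.some.trans h'.some⟩

theorem congr {a b a' b' : Submodule R M} {c d c' d' : Submodule R N} (h : QuotIso R a b c d)
    (ha : a' = a) (hb : b' = b) (hc : c' = c) (hd : d' = d) : QuotIso R a' b' c' d' := by
  subst ha hb hc hd
  exact h

/-- A linear map which is surjective from `b` onto `d` and pulls `c` back to `a` identifies the
quotients. -/
theorem of_linearMap (f : M →ₗ[R] N) {a b : Submodule R M} {c d : Submodule R N}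
    (hf : ∀ x ∈ b, f x ∈ d) (hs : ∀ y ∈ d, ∃ x ∈ b, f x = y)
    (hk : ∀ x ∈ b, f x ∈ c ↔ x ∈ a) : QuotIso R a b c d := by
  let q : b →ₗ[R] (↥d ⧸ Submodule.comap d.subtype c) :=
    (Submodule.mkQ _).comp (f.restrict hf)
  have hq : Function.Surjective q := by
    intro y
    obtain ⟨⟨y, hy⟩, rfl⟩ := Submodule.mkQ_surjective _ y
    obtain ⟨x, hx, rfl⟩ := hs y hy
    exact ⟨⟨x, hx⟩, rfl⟩
  have hker : LinearMap.ker q = Submodule.comap b.subtype a := by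
    ext x
    simp only [q, LinearMap.mem_ker, LinearMap.comp_apply, Submodule.mkQ_apply,
      Submodule.Quotient.mk_eq_zero, Submodule.mem_comap, Submodule.subtype_apply]
    exact hk x x.2
  exact ⟨(Submodule.quotEquivOfEq _ _ hker.symm).trans (q.quotKerEquivOfSurjective hq)⟩

theorem map_injective (f : M →ₗ[R] N) (hf : Function.Injective f) (a b : Submodule R M) :
    QuotIso R a b (a.map f) (b.map f) :=
  of_linearMap f (fun _ hx => Submodule.mem_map_of_mem hx) (fun _ hy => hy)
    fun _ _ => hf.mem_set_image

theorem covBy {a b : Submodule R M} {c d : Submodule R N} (h : QuotIso R a b c d)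
    (hab : a ⋖ b) (hcd : c ≤ d) : c ⋖ d := by
  have := (covBy_iff_quot_is_simple hab.le).mp hab
  exact (covBy_iff_quot_is_simple hcd).mpr (IsSimpleModule.congr h.some.symm)

end QuotIso

/-- The image of a composition series under an injective linear map. -/
def CompositionSeries.mapInjective {R : Type} [Ring R] {M N : Type} [AddCommGroup M] [Module R M]
    [AddCommGroup N] [Module R N] (s : CompositionSeries (Submodule R M)) (f : M →ₗ[R] N)
    (hf : Function.Injective f) : CompositionSeries (Submodule R N) where
  length := s.length
  toFun i := (s i).map f
  step i := (QuotIso.map_injective f hf (s i.castSucc) (s i.succ)).covBy (s.step i)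
    (Submodule.map_mono (s.step i).le)

namespace SameCompFactors

variable {R : Type} [Ring R] {M N P : Type} [AddCommGroup M] [Module R M]
    [AddCommGroup N] [Module R N] [AddCommGroup P] [Module R P]

theorem symm (h : SameCompFactors R M N) : SameCompFactors R N M := by
  obtain ⟨s, t, h1, h2, h3, h4, e, he⟩ := h
  exact ⟨t, s, h3, h4, h1, h2, e.symm, fun i => by
    have := he (e.symm i)
    rw [e.apply_symm_apply] at this
    exact this.map LinearEquiv.symm⟩

theorem trans (h : SameCompFactors R M N) (h' : SameCompFactors R N P) :
    SameCompFactors R M P := by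
  obtain ⟨s, t, h1, h2, h3, h4, e, he⟩ := h
  obtain ⟨t', u, h3', h4', h5, h6, e', he'⟩ := h'
  obtain ⟨f, hf⟩ := t.jordan_holder t' (h3.trans h3'.symm) (h4.trans h4'.symm)
  exact ⟨s, u, h1, h2, h5, h6, e.trans (f.trans e'), fun i =>
    (QuotIso.trans (he i) ⟨(hf (e i)).linearEquiv⟩).trans (he' _)⟩

theorem isFiniteLength_left (h : SameCompFactors R M N) : IsFiniteLength R M := by
  obtain ⟨s, t, h1, h2, -⟩ := h
  exact isFiniteLength_of_exists_compositionSeries ⟨s, h1, h2⟩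

theorem of_linearEquiv (hM : IsFiniteLength R M) (e : M ≃ₗ[R] N) : SameCompFactors R M N := by
  obtain ⟨s, h1, h2⟩ := isFiniteLength_iff_exists_compositionSeries.mp hM
  refine ⟨s, s.mapInjective e.toLinearMap e.injective, h1, h2, ?_, ?_, Equiv.refl _, fun i =>
    QuotIso.map_injective e.toLinearMap e.injective _ _⟩
  · exact (congrArg (Submodule.map e.toLinearMap) h1).trans (Submodule.map_bot _)
  · exact (congrArg (Submodule.map e.toLinearMap) h2).trans
      (Submodule.map_top _ |>.trans (LinearMap.range_eq_top.mpr e.surjective))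

/-- Two composition series with isomorphic factors, extended on top by isomorphic factors. -/
theorem of_snoc (s : CompositionSeries (Submodule R M)) (t : CompositionSeries (Submodule R N))
    (hs : s.head = ⊥) (ht : t.head = ⊥) (f : Fin s.length ≃ Fin t.length)
    (hf : ∀ i, QuotIso R (s i.castSucc) (s i.succ) (t (f i).castSucc) (t (f i).succ))
    (hs' : s.last ⋖ ⊤) (ht' : t.last ⋖ ⊤) (hst : QuotIso R s.last ⊤ t.last ⊤) :
    SameCompFactors R M N := by
  let e : Fin (s.length + 1) ≃ Fin (t.length + 1) :=
    finSuccEquivLast.trans ((Functor.mapEquiv Option f).trans finSuccEquivLast.symm)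
  have he_last : e (Fin.last s.length) = Fin.last t.length := by
    simp [e, finSuccEquivLast_last, Functor.mapEquiv_apply]
  have he_castSucc (j : Fin s.length) : e j.castSucc = (f j).castSucc := by
    simp [e, finSuccEquivLast_castSucc, Functor.mapEquiv_apply]
  have key : ∀ i : Fin (s.length + 1), QuotIso R
      (s.snoc ⊤ hs' (Fin.castSucc i)) (s.snoc ⊤ hs' (Fin.succ i))
      (t.snoc ⊤ ht' (Fin.castSucc (e i))) (t.snoc ⊤ ht' (Fin.succ (e i))) := by
    intro i
    refine Fin.lastCases ?_ (fun i => ?_) i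
    · rw [he_last]
      exact hst.congr (RelSeries.snoc_castSucc s ⊤ hs' (Fin.last _)) (RelSeries.last_snoc' s ⊤ hs')
        (RelSeries.snoc_castSucc t ⊤ ht' (Fin.last _)) (RelSeries.last_snoc' t ⊤ ht')
    · rw [he_castSucc]
      exact (hf i).congr (RelSeries.snoc_castSucc s ⊤ hs' _) (RelSeries.snoc_castSucc s ⊤ hs' i.succ)
        (RelSeries.snoc_castSucc t ⊤ ht' _) (RelSeries.snoc_castSucc t ⊤ ht' (f i).succ)
  exact ⟨s.snoc ⊤ hs', t.snoc ⊤ ht', by simpa using hs, by simp, by simpa using ht, by simp, e, key⟩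

/-- Extending two modules with the same composition factors by isomorphic simple modules. -/
theorem of_submodule {K : Submodule R M} {L : Submodule R N} (h : SameCompFactors R K L)
    (hs : IsSimpleModule R (M ⧸ K)) (e : (M ⧸ K) ≃ₗ[R] (N ⧸ L)) : SameCompFactors R M N := by
  obtain ⟨s, t, h1, h2, h3, h4, f, hf⟩ := h
  have hsK : (s.mapInjective K.subtype K.subtype_injective).last = K :=
    (congrArg (Submodule.map K.subtype) h2).trans (Submodule.map_subtype_top K)
  have htL : (t.mapInjective L.subtype L.subtype_injective).last = L :=
    (congrArg (Submodule.map L.subtype) h4).trans (Submodule.map_subtype_top L)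
  have hsb : (s.mapInjective K.subtype K.subtype_injective).head = ⊥ :=
    (congrArg (Submodule.map K.subtype) h1).trans (Submodule.map_bot _)
  have htb : (t.mapInjective L.subtype L.subtype_injective).head = ⊥ :=
    (congrArg (Submodule.map L.subtype) h3).trans (Submodule.map_bot _)
  have hf' : ∀ i : Fin s.length, QuotIso R
      (s.mapInjective K.subtype K.subtype_injective i.castSucc)
      (s.mapInjective K.subtype K.subtype_injective i.succ)
      (t.mapInjective L.subtype L.subtype_injective (f i).castSucc)
      (t.mapInjective L.subtype L.subtype_injective (f i).succ) := fun i =>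
    ((QuotIso.map_injective K.subtype K.subtype_injective _ _).symm.trans (hf i)).trans
      (QuotIso.map_injective L.subtype L.subtype_injective _ _)
  have hK : K ⋖ ⊤ := covBy_top_iff.mpr (isSimpleModule_iff_isCoatom.mp hs)
  have hL : L ⋖ ⊤ :=
    covBy_top_iff.mpr (isSimpleModule_iff_isCoatom.mp (IsSimpleModule.congr e.symm))
  have hKL : QuotIso R K ⊤ L ⊤ := by
    have hK' : QuotIso R K ⊤ ⊥ (⊤ : Submodule R (M ⧸ K)) :=
      .of_linearMap K.mkQ (by simp)
        (fun y _ => (K.mkQ_surjective y).imp fun x hx => ⟨trivial, hx⟩) (by simp)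
    have hL' : QuotIso R L ⊤ ⊥ (⊤ : Submodule R (N ⧸ L)) :=
      .of_linearMap L.mkQ (by simp)
        (fun y _ => (L.mkQ_surjective y).imp fun x hx => ⟨trivial, hx⟩) (by simp)
    have he : QuotIso R ⊥ (⊤ : Submodule R (M ⧸ K)) ⊥ (⊤ : Submodule R (N ⧸ L)) :=
      .of_linearMap e.toLinearMap (by simp) (fun y _ => ⟨e.symm y, by simp⟩) (by simp)
    exact (hK'.trans he).trans hL'.symm
  exact of_snoc _ _ hsb htb f hf' (by rwa [hsK]) (by rwa [htL]) (hKL.congr hsK rfl htL rfl)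

/-- Two extensions of the same finite length modules have the same composition factors. -/
theorem of_exact {B A : Type} [AddCommGroup B] [Module R B] [AddCommGroup A] [Module R A]
    (hB : IsFiniteLength R B) (hA : IsFiniteLength R A) :
    ∀ (M N : Type) [AddCommGroup M] [Module R M] [AddCommGroup N] [Module R N]
    (f : B →ₗ[R] M) (g : M →ₗ[R] A) (f' : B →ₗ[R] N) (g' : N →ₗ[R] A),
    Function.Injective f → Function.Exact f g → Function.Surjective g →
    Function.Injective f' → Function.Exact f' g' → Function.Surjective g' →
    SameCompFactors R M N := by
  induction hA with
  | of_subsingleton =>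
    intro M N _ _ _ _ f g f' g' hf he _ hf' he' _
    have h1 : Function.Surjective f := fun y => (he y).mp (Subsingleton.elim _ _)
    have h2 : Function.Surjective f' := fun y => (he' y).mp (Subsingleton.elim _ _)
    exact (of_linearEquiv hB (.ofBijective f ⟨hf, h1⟩)).symm.trans
      (of_linearEquiv hB (.ofBijective f' ⟨hf', h2⟩))
  | @of_simple_quotient A _ _ S hS _ ih =>
    intro M N _ _ _ _ f g f' g' hf he hg hf' he' hg'
    have key : ∀ (M : Type) [AddCommGroup M] [Module R M] (f : B →ₗ[R] M) (g : M →ₗ[R] A)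
        (hf : Function.Injective f) (he : Function.Exact f g) (hg : Function.Surjective g),
        ∃ (f₁ : B →ₗ[R] (S.comap g)) (g₁ : S.comap g →ₗ[R] S),
          Function.Injective f₁ ∧ Function.Exact f₁ g₁ ∧ Function.Surjective g₁ ∧
          Nonempty ((M ⧸ S.comap g) ≃ₗ[R] (A ⧸ S)) := by
      intro M _ _ f g hf he hg
      refine ⟨f.codRestrict _ fun b => ?_, g.restrict fun x hx => hx, ?_, ?_, ?_, ?_⟩
      · simp [he.apply_apply_eq_zero]
      · exact fun x y h => hf (congrArg Subtype.val h)
      · intro x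
        rw [Subtype.ext_iff]
        refine (he x).trans ⟨?_, ?_⟩
        · rintro ⟨b, hb⟩
          exact ⟨b, Subtype.ext hb⟩
        · rintro ⟨b, hb⟩
          exact ⟨b, congrArg Subtype.val hb⟩
      · rintro ⟨y, hy⟩
        obtain ⟨x, rfl⟩ := hg y
        exact ⟨⟨x, hy⟩, rfl⟩
      · have h1 : LinearMap.ker (S.mkQ.comp g) = S.comap g := by
          rw [LinearMap.ker_comp, Submodule.ker_mkQ]
        exact ⟨(Submodule.quotEquivOfEq _ _ h1.symm).trans
          (LinearMap.quotKerEquivOfSurjective _ (S.mkQ_surjective.comp hg))⟩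
    obtain ⟨f₁, g₁, a1, a2, a3, ⟨a4⟩⟩ := key M f g hf he hg
    obtain ⟨f₂, g₂, b1, b2, b3, ⟨b4⟩⟩ := key N f' g' hf' he' hg'
    exact of_submodule (ih _ _ f₁ g₁ f₂ g₂ a1 a2 a3 b1 b2 b3) (IsSimpleModule.congr a4)
      (a4.trans b4.symm)

end SameCompFactors

/-- A module with the same composition factors as a simple module is isomorphic to it. -/
theorem SameCompFactors.nonempty_linearEquiv {R : Type} [Ring R] {M N : Type} [AddCommGroup M]
    [Module R M] [AddCommGroup N] [Module R N] (h : SameCompFactors R M N)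
    (hM : IsSimpleModule R M) : Nonempty (M ≃ₗ[R] N) := by
  obtain ⟨s, t, h1, h2, h3, h4, e, he⟩ := h
  have hs : s.length = 1 := by
    have := Module.length_compositionSeries s h1 h2
    rw [Module.length_eq_one] at this
    exact_mod_cast this
  have ht : t.length = 1 := by
    have := Fintype.card_congr e
    simp only [Fintype.card_fin] at this
    omega
  have factor : ∀ (P : Type) [AddCommGroup P] [Module R P] (u : CompositionSeries (Submodule R P)),
      u.head = ⊥ → u.last = ⊤ → u.length = 1 → ∀ i : Fin u.length,
      QuotIso R (u i.castSucc) (u i.succ) ⊥ (⊤ : Submodule R P) := by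
    intro P _ _ u hb ht hu i
    have h0 : i.castSucc = 0 := by ext; simp; omega
    have h1 : i.succ = Fin.last _ := by ext; simp; omega
    rw [h0, h1]
    exact QuotIso.congr ⟨.refl R _⟩ hb ht rfl rfl
  have botTop : ∀ (P : Type) [AddCommGroup P] [Module R P],
      Nonempty ((↥(⊤ : Submodule R P) ⧸ Submodule.comap (⊤ : Submodule R P).subtype ⊥) ≃ₗ[R] P) :=
    fun P _ _ => ⟨(Submodule.quotEquivOfEqBot _ (by simp)).trans Submodule.topEquiv⟩
  have i : Fin s.length := ⟨0, by omega⟩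
  obtain ⟨f⟩ := ((factor M s h1 h2 hs i).symm.trans (he i)).trans (factor N t h3 h4 ht (e i))
  exact ⟨(botTop M).some.symm.trans (f.trans (botTop N).some)⟩

namespace TriangularAlg

set_option linter.unusedSectionVars false

variable {A V : Type} [Ring A] [AddCommGroup V] [Module A V] [Module Aᵐᵒᵖ V]
  [SMulCommClass A Aᵐᵒᵖ V]

variable (A V) in
/-- The diagonal embedding of `A` in the triangular matrix algebra. -/
def diag : A →+* TriangularAlg A V :=
  (TrivSqZeroExt.inlHom (A × A) V).comp ((RingHom.id A).prod (RingHom.id A))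

variable (A V) in
/-- The idempotent `e₁₁`. -/
def e₁ : TriangularAlg A V := TrivSqZeroExt.inl (1, 0)

variable (A) in
/-- The matrix with entry `m` in the upper right corner. -/
def corner (m : V) : TriangularAlg A V := TrivSqZeroExt.inr m

theorem e₁_mul_e₁ : e₁ A V * e₁ A V = e₁ A V := by
  simp [e₁, ← TrivSqZeroExt.inl_mul]

theorem e₁_mul_diag (a : A) : e₁ A V * diag A V a = diag A V a * e₁ A V := by
  simp [e₁, diag, ← TrivSqZeroExt.inl_mul]

theorem e₁_mul_corner (m : V) : e₁ A V * corner A m = corner A m := by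
  rw [e₁, corner, TrivSqZeroExt.inl_mul_inr]
  exact congrArg _ (one_smul A m)

theorem corner_mul_e₁ (m : V) : corner A m * e₁ A V = 0 := by
  rw [e₁, corner, TrivSqZeroExt.inr_mul_inl]
  exact (congrArg _ (zero_smul Aᵐᵒᵖ m)).trans (TrivSqZeroExt.inr_zero _)

theorem diag_mul_corner (a : A) (m : V) : diag A V a * corner A m = corner A (a • m) :=
  TrivSqZeroExt.inl_mul_inr _ _

theorem corner_mul_diag (a : A) (m : V) :
    corner A m * diag A V a = corner A (MulOpposite.op a • m) :=
  TrivSqZeroExt.inr_mul_inl _ _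

theorem corner_add (m n : V) : corner A (m + n) = corner A m + corner A n :=
  TrivSqZeroExt.inr_add _ _ _

theorem corner_zero : corner A (0 : V) = 0 := TrivSqZeroExt.inr_zero ..

theorem eq_sum (g : TriangularAlg A V) :
    g = e₁ A V * diag A V g.fst.1 + (1 - e₁ A V) * diag A V g.fst.2 + corner A g.snd := by
  have h : (1 : TriangularAlg A V) - e₁ A V = TrivSqZeroExt.inl (0, 1) := by
    rw [e₁, ← TrivSqZeroExt.inl_one, ← TrivSqZeroExt.inl_sub]
    congr 1
    ext <;> simp
  rw [h]
  ext <;> simp [e₁, diag, corner]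

variable {X Y : Type} [AddCommGroup X] [Module (TriangularAlg A V) X]
  [AddCommGroup Y] [Module (TriangularAlg A V) Y]

theorem e₁_smul_e₁_smul (x : X) : e₁ A V • e₁ A V • x = e₁ A V • x := by
  rw [smul_smul, e₁_mul_e₁]

theorem e₁_smul_diag_smul (a : A) (x : X) :
    e₁ A V • diag A V a • x = diag A V a • e₁ A V • x := by
  rw [smul_smul, smul_smul, e₁_mul_diag]

theorem e₁_smul_corner_smul (m : V) (x : X) : e₁ A V • corner A m • x = corner A m • x := by
  rw [smul_smul, e₁_mul_corner]

theorem corner_smul_e₁_smul (m : V) (x : X) : corner A m • e₁ A V • x = 0 := by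
  rw [smul_smul, corner_mul_e₁, zero_smul]

theorem diag_smul_corner_smul (a : A) (m : V) (x : X) :
    diag A V a • corner A m • x = corner A (a • m) • x := by
  rw [smul_smul, diag_mul_corner]

theorem corner_smul_diag_smul (a : A) (m : V) (x : X) :
    corner A m • diag A V a • x = corner A (MulOpposite.op a • m) • x := by
  rw [smul_smul, corner_mul_diag]

/-- A subgroup stable under the diagonal, the idempotent and the corner is a submodule. -/
def submoduleOfStable (N : AddSubgroup X) (hd : ∀ (a : A), ∀ x ∈ N, diag A V a • x ∈ N)
    (he : ∀ x ∈ N, e₁ A V • x ∈ N) (hm : ∀ (m : V), ∀ x ∈ N, corner A m • x ∈ N) :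
    Submodule (TriangularAlg A V) X where
  __ := N
  smul_mem' g x hx := by
    rw [eq_sum g, add_smul, add_smul, mul_smul, mul_smul, sub_smul, one_smul]
    exact N.add_mem (N.add_mem (he _ (hd _ _ hx)) (N.sub_mem (hd _ _ hx) (he _ (hd _ _ hx))))
      (hm _ _ hx)

variable (A V X) in
/-- Every element of `e₁ X` is a sum of multiples by corner elements. -/
def CornerGenerates : Prop :=
  ∀ p : X → Prop, (∀ x y, p x → p y → p (x + y)) → p 0 →
    (∀ (m : V) (x : X), p (corner A m • x)) → ∀ x, p (e₁ A V • x)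

/-- The action of `A` on a module over the triangular matrix algebra through the diagonal. -/
abbrev diagModule : Module A X := Module.compHom X (diag A V)

/-- Over a semisimple ring, an indecomposable module over the triangular matrix algebra is simple
unless its corner map is surjective. -/
theorem isSimpleModule_or_cornerGenerates [IsSemisimpleRing A]
    (hX : IsIndecomposable (TriangularAlg A V) X) :
    IsSimpleModule (TriangularAlg A V) X ∨ CornerGenerates A V X := by
  let _ : Module A X := diagModule (V := V)
  have hsmul : ∀ (a : A) (x : X), a • x = diag A V a • x := fun _ _ => rfl
  by_cases h2 : ∀ x : X, e₁ A V • x = x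
  · left
    have hm : ∀ (m : V) (x : X), corner A m • x = 0 := fun m x => by
      rw [← h2 x, corner_smul_e₁_smul]
    have := hX.1
    have key : ∀ N : Submodule (TriangularAlg A V) X, N = ⊥ ∨ N = ⊤ := by
      intro N
      let N' : Submodule A X := { N with smul_mem' := fun a x hx => N.smul_mem (diag A V a) hx }
      obtain ⟨C, hC⟩ := exists_isCompl N'
      let C' : Submodule (TriangularAlg A V) X := submoduleOfStable C.toAddSubgroup
        (fun a x hx => C.smul_mem a hx) (fun x hx => by rwa [h2 x])
        (fun m x hx => by rw [hm]; exact C.zero_mem)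
      have hNC : IsCompl N C' := by
        rw [isCompl_iff, Submodule.disjoint_def, codisjoint_iff, Submodule.eq_top_iff']
        refine ⟨fun x hx hx' => Submodule.disjoint_def.mp hC.1 x hx hx', fun x => ?_⟩
        have hx : x ∈ N' ⊔ C := by rw [hC.sup_eq_top]; trivial
        obtain ⟨y, hy, z, hz, rfl⟩ := Submodule.mem_sup.mp hx
        exact Submodule.mem_sup.mpr ⟨y, hy, z, hz, rfl⟩
      refine (hX.2 N C' hNC).imp_right fun h => ?_
      rw [h] at hNC
      simpa using hNC.sup_eq_top
    exact { eq_bot_or_eq_top := key }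
  · right
    let I : Submodule A X :=
      { AddSubmonoid.closure {y : X | ∃ (m : V) (x : X), corner A m • x = y} with
        smul_mem' := by
          intro a x hx
          refine AddSubmonoid.closure_induction (motive := fun x _ => a • x ∈ AddSubmonoid.closure
            {y : X | ∃ (m : V) (x : X), corner A m • x = y}) ?_ ?_ ?_ hx
          · rintro _ ⟨m, x, rfl⟩
            rw [hsmul, diag_smul_corner_smul]
            exact AddSubmonoid.subset_closure ⟨_, _, rfl⟩
          · rw [smul_zero]; exact zero_mem _
          · intro x y _ _ hx hy
            rw [smul_add]; exact add_mem hx hy }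
    have hI : ∀ (m : V) (x : X), corner A m • x ∈ I := fun m x =>
      AddSubmonoid.subset_closure ⟨_, _, rfl⟩
    have hIe : ∀ x ∈ I, e₁ A V • x = x := by
      intro x hx
      refine AddSubmonoid.closure_induction (motive := fun x _ => e₁ A V • x = x) ?_ ?_ ?_ hx
      · rintro _ ⟨m, x, rfl⟩
        exact e₁_smul_corner_smul m x
      · exact smul_zero _
      · intro x y _ _ hx hy
        rw [smul_add, hx, hy]
    obtain ⟨C, hC⟩ := exists_isCompl I
    let P : Submodule (TriangularAlg A V) X := submoduleOfStable
      { carrier := {x | x ∈ C ∧ e₁ A V • x = x}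
        zero_mem' := ⟨C.zero_mem, smul_zero _⟩
        add_mem' := fun {x y} hx hy => ⟨C.add_mem hx.1 hy.1, by rw [smul_add, hx.2, hy.2]⟩
        neg_mem' := fun {x} hx => ⟨C.neg_mem hx.1, by rw [smul_neg, hx.2]⟩ }
      (fun a x hx => ⟨C.smul_mem a hx.1, by rw [e₁_smul_diag_smul, hx.2]⟩)
      (fun x hx => by rw [hx.2]; exact hx)
      (fun m x hx => by rw [← hx.2, corner_smul_e₁_smul]; exact zero_mem _)
    let Q : Submodule (TriangularAlg A V) X := submoduleOfStable
      { carrier := {x | e₁ A V • x ∈ I}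
        zero_mem' := by rw [Set.mem_ofPred_eq, smul_zero]; exact I.zero_mem
        add_mem' := fun {x y} hx hy => by
          rw [Set.mem_ofPred_eq, smul_add]; exact I.add_mem hx hy
        neg_mem' := fun {x} hx => by rw [Set.mem_ofPred_eq, smul_neg]; exact I.neg_mem hx }
      (fun a x hx => by
        change e₁ A V • _ ∈ I
        rw [e₁_smul_diag_smul]; exact I.smul_mem a hx)
      (fun x hx => by
        change e₁ A V • _ ∈ I
        rw [e₁_smul_e₁_smul]; exact hx)
      (fun m x hx => by
        change e₁ A V • _ ∈ I
        rw [e₁_smul_corner_smul]; exact hI m x)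
    have hPQ : IsCompl P Q := by
      rw [isCompl_iff, Submodule.disjoint_def, codisjoint_iff, Submodule.eq_top_iff']
      refine ⟨fun x hx hx' => ?_, fun x => ?_⟩
      · have h : e₁ A V • x ∈ I := hx'
        rw [hx.2] at h
        exact Submodule.disjoint_def.mp hC.1 x h hx.1
      · have hx : e₁ A V • x ∈ I ⊔ C := by rw [hC.sup_eq_top]; trivial
        obtain ⟨y, hy, z, hz, hyz⟩ := Submodule.mem_sup.mp hx
        have hz' : z = e₁ A V • x - y := by rw [← hyz]; abel
        have hez : e₁ A V • z = z := by rw [hz', smul_sub, e₁_smul_e₁_smul, hIe y hy]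
        refine Submodule.mem_sup.mpr ⟨z, ⟨hz, hez⟩, x - z, ?_, by abel⟩
        change e₁ A V • _ ∈ I
        rwa [smul_sub, hez, ← hyz, add_sub_cancel_right]
    rcases hX.2 P Q hPQ with h | h
    · intro p hadd h0 hp x
      have hx : x ∈ Q := by
        rw [h] at hPQ
        rw [show Q = ⊤ by simpa using hPQ.sup_eq_top]
        trivial
      refine AddSubmonoid.closure_induction (motive := fun x _ => p x) ?_ h0
        (fun x y _ _ => hadd x y) (show e₁ A V • x ∈ I from hx)
      rintro _ ⟨m, x, rfl⟩
      exact hp m x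
    · refine absurd (fun x => ?_) h2
      have hx : x - e₁ A V • x ∈ Q := by
        change e₁ A V • _ ∈ I
        rw [smul_sub, e₁_smul_e₁_smul, sub_self]
        exact I.zero_mem
      rw [h, Submodule.mem_bot] at hx
      exact (sub_eq_zero.mp hx).symm

/-- The pair `π : Λ → A`, `j : V → Λ` exhibits `V` as the kernel of the surjection `π`,
compatibly with the bimodule structures. -/
structure IsSquareZeroCover {Λ : Type} [Ring Λ] (π : Λ →+* A) (j : V →+ Λ) : Prop where
  surjective : Function.Surjective π
  injective : Function.Injective j
  map_eq_zero_iff : ∀ x, π x = 0 ↔ ∃ m, j m = x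
  left_smul : ∀ x m, j (π x • m) = x * j m
  right_smul : ∀ x m, j (MulOpposite.op (π x) • m) = j m * x

variable {Λ : Type} [Ring Λ] {π : Λ →+* A} {j : V →+ Λ}
  {M N : Type} [AddCommGroup M] [Module Λ M] [AddCommGroup N] [Module Λ N]

/-- The `Λ`-module `M` is an extension of `X / e₁ X` by `e₁ X` whose multiplication by the
kernel of `π` is the corner map of `X`. -/
structure IsGluing (π : Λ →+* A) (j : V →+ Λ) (i : X →+ M) (p : M →+ X) : Prop where
  i_smul : ∀ x y, i (diag A V (π x) • y) = x • i y
  p_smul : ∀ x v, p (x • v) = diag A V (π x) • p v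
  i_eq_zero : ∀ x, i x = 0 ↔ e₁ A V • x = 0
  e₁_smul_p : ∀ v, e₁ A V • p v = 0
  p_surj : ∀ x : X, e₁ A V • x = 0 → ∃ v, p v = x
  p_eq_zero : ∀ v, p v = 0 ↔ ∃ x, i x = v
  j_smul : ∀ m v, j m • v = i (corner A m • p v)

namespace IsGluing

variable {i : X →+ M} {p : M →+ X} {i' : Y →+ N} {p' : N →+ Y}

theorem i_e₁_smul (h : IsGluing π j i p) (x : X) : i (e₁ A V • x) = i x := by
  have : i (e₁ A V • x - x) = 0 := by
    rw [h.i_eq_zero, smul_sub, e₁_smul_e₁_smul, sub_self]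
  rwa [map_sub, sub_eq_zero] at this

theorem p_i (h : IsGluing π j i p) (x : X) : p (i x) = 0 := (h.p_eq_zero _).mpr ⟨x, rfl⟩

/-- An `X`-valued element killed by `e₁` lifts, in the form `x - e₁ x`. -/
theorem exists_p_eq (h : IsGluing π j i p) (x : X) : ∃ v, p v = x - e₁ A V • x :=
  h.p_surj _ (by rw [smul_sub, e₁_smul_e₁_smul, sub_self])

theorem nontrivial (h : IsGluing π j i p) [Nontrivial X] : Nontrivial M := by
  by_contra hM
  rw [not_nontrivial_iff_subsingleton] at hM
  obtain ⟨x, hx⟩ := exists_ne (0 : X)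
  have h1 := (h.i_eq_zero x).mp (Subsingleton.elim _ _)
  obtain ⟨v, rfl⟩ := h.p_surj x h1
  exact hx (by rw [Subsingleton.elim v 0, map_zero])

theorem corner_smul_eq (h : IsGluing π j i p) (m : V) {x : X} {v : M}
    (hv : p v = x - e₁ A V • x) : corner A m • x = corner A m • p v := by
  rw [hv, smul_sub, corner_smul_e₁_smul, sub_zero]

/-- The part of `X` cut out by a submodule of the glued module `M`. -/
def part (h : IsGluing π j i p) (P : Submodule Λ M) (hπ : Function.Surjective π) :
    Submodule (TriangularAlg A V) X :=
  submoduleOfStable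
    { carrier := {x | i x ∈ P ∧ ∃ v ∈ P, p v = x - e₁ A V • x}
      zero_mem' := ⟨by rw [map_zero]; exact P.zero_mem, 0, P.zero_mem, by simp⟩
      add_mem' := by
        rintro x y ⟨hx, v, hv, hvx⟩ ⟨hy, w, hw, hwy⟩
        refine ⟨by rw [map_add]; exact P.add_mem hx hy, v + w, P.add_mem hv hw, ?_⟩
        rw [map_add, hvx, hwy, smul_add]; abel
      neg_mem' := by
        rintro x ⟨hx, v, hv, hvx⟩
        refine ⟨by rw [map_neg]; exact P.neg_mem hx, -v, P.neg_mem hv, ?_⟩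
        rw [map_neg, hvx, smul_neg]; abel }
    (by
      rintro a x ⟨hx, v, hv, hvx⟩
      obtain ⟨r, rfl⟩ := hπ a
      refine ⟨by rw [h.i_smul]; exact P.smul_mem _ hx, r • v, P.smul_mem _ hv, ?_⟩
      rw [h.p_smul, hvx, smul_sub, e₁_smul_diag_smul])
    (by
      rintro x ⟨hx, v, hv, hvx⟩
      refine ⟨by rwa [h.i_e₁_smul], 0, P.zero_mem, ?_⟩
      rw [map_zero, e₁_smul_e₁_smul, sub_self])
    (by
      rintro m x ⟨hx, v, hv, hvx⟩
      refine ⟨?_, 0, P.zero_mem, ?_⟩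
      · rw [h.corner_smul_eq m hvx, ← h.j_smul]
        exact P.smul_mem _ hv
      · rw [map_zero, e₁_smul_corner_smul, sub_self])

theorem mem_part {h : IsGluing π j i p} {P : Submodule Λ M} {hπ : Function.Surjective π} {x : X} :
    x ∈ h.part P hπ ↔ i x ∈ P ∧ ∃ v ∈ P, p v = x - e₁ A V • x := Iff.rfl

theorem eq_bot_of_part_eq_bot (h : IsGluing π j i p) {P : Submodule Λ M}
    (hπ : Function.Surjective π) (hP : h.part P hπ = ⊥) : P = ⊥ := by
  rw [eq_bot_iff]
  intro v hv
  have h1 : p v ∈ h.part P hπ := by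
    refine mem_part.mpr ⟨?_, v, hv, by rw [h.e₁_smul_p, sub_zero]⟩
    rw [(h.i_eq_zero _).mpr (h.e₁_smul_p v)]
    exact P.zero_mem
  rw [hP, Submodule.mem_bot] at h1
  obtain ⟨x, rfl⟩ := (h.p_eq_zero v).mp h1
  have h2 : e₁ A V • x ∈ h.part P hπ := by
    refine mem_part.mpr ⟨by rwa [h.i_e₁_smul], 0, P.zero_mem, ?_⟩
    rw [map_zero, e₁_smul_e₁_smul, sub_self]
  rw [hP, Submodule.mem_bot] at h2
  exact (h.i_eq_zero x).mpr h2

/-- The kernel part of a decomposed glued module decomposes accordingly. -/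
theorem exists_i_add (h : IsGluing π j i p) (hX : CornerGenerates A V X) {P Q : Submodule Λ M}
    (hPQ : IsCompl P Q) (x : X) : ∃ y z : X, e₁ A V • x = e₁ A V • y + e₁ A V • z ∧
      i y ∈ P ∧ i z ∈ Q := by
  suffices H : ∃ y z : X, e₁ A V • e₁ A V • x = e₁ A V • y + e₁ A V • z ∧ i y ∈ P ∧ i z ∈ Q by
    obtain ⟨y, z, h1, h2, h3⟩ := H
    exact ⟨y, z, by rwa [e₁_smul_e₁_smul] at h1, h2, h3⟩
  refine hX (fun x => ∃ y z : X, e₁ A V • x = e₁ A V • y + e₁ A V • z ∧ i y ∈ P ∧ i z ∈ Q)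
    ?_ ?_ ?_ x
  · rintro x x' ⟨y, z, h1, h2, h3⟩ ⟨y', z', h1', h2', h3'⟩
    refine ⟨y + y', z + z', ?_, ?_, ?_⟩
    · rw [smul_add, smul_add, smul_add, h1, h1']; abel
    · rw [map_add]; exact P.add_mem h2 h2'
    · rw [map_add]; exact Q.add_mem h3 h3'
  · exact ⟨0, 0, by simp, by rw [map_zero]; exact P.zero_mem, by rw [map_zero]; exact Q.zero_mem⟩
  · intro m x
    obtain ⟨v, hv⟩ := h.exists_p_eq x
    have hvt : v ∈ P ⊔ Q := by rw [hPQ.sup_eq_top]; trivial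
    obtain ⟨a, ha, b, hb, rfl⟩ := Submodule.mem_sup.mp hvt
    refine ⟨corner A m • p a, corner A m • p b, ?_, ?_, ?_⟩
    · rw [h.corner_smul_eq m hv, map_add, smul_add, smul_add]
    · rw [← h.j_smul]; exact P.smul_mem _ ha
    · rw [← h.j_smul]; exact Q.smul_mem _ hb

theorem isCompl_part (h : IsGluing π j i p) (hπ : Function.Surjective π)
    (hX : CornerGenerates A V X) {P Q : Submodule Λ M} (hPQ : IsCompl P Q) :
    IsCompl (h.part P hπ) (h.part Q hπ) := by
  have hd := Submodule.disjoint_def.mp hPQ.1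
  rw [isCompl_iff, Submodule.disjoint_def, codisjoint_iff, Submodule.eq_top_iff']
  constructor
  · intro x hx hx'
    obtain ⟨h1, v, hv, hvx⟩ := mem_part.mp hx
    obtain ⟨h2, w, hw, hwx⟩ := mem_part.mp hx'
    have hex := (h.i_eq_zero x).mp (hd _ h1 h2)
    rw [hex, sub_zero] at hvx hwx
    obtain ⟨b, hb⟩ := (h.p_eq_zero (v - w)).mp (by rw [map_sub, hvx, hwx, sub_self])
    obtain ⟨y, z, hyz, hy, hz⟩ := h.exists_i_add hX hPQ b
    have hsum : i y + i z = v - w := by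
      rw [← hb, ← h.i_e₁_smul b, hyz, map_add, h.i_e₁_smul, h.i_e₁_smul]
    have hvy : v - i y = 0 := by
      refine hd _ (P.sub_mem hv hy) ?_
      have : v - i y = w + i z := by
        rw [sub_eq_iff_eq_add, add_assoc, add_comm (i z), hsum]; abel
      rw [this]
      exact Q.add_mem hw hz
    rw [← hvx, sub_eq_zero.mp hvy, h.p_i]
  · intro x
    obtain ⟨y, z, hyz, hy, hz⟩ := h.exists_i_add hX hPQ x
    obtain ⟨v, hv⟩ := h.exists_p_eq x
    have hvt : v ∈ P ⊔ Q := by rw [hPQ.sup_eq_top]; trivial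
    obtain ⟨a, ha, b, hb, rfl⟩ := Submodule.mem_sup.mp hvt
    have hi : ∀ v, i (p v) = 0 := fun v => (h.i_eq_zero _).mpr (h.e₁_smul_p v)
    refine Submodule.mem_sup.mpr ⟨e₁ A V • y + p a, mem_part.mpr ⟨?_, a, ha, ?_⟩,
      e₁ A V • z + p b, mem_part.mpr ⟨?_, b, hb, ?_⟩, ?_⟩
    · rwa [map_add, h.i_e₁_smul, hi, add_zero]
    · rw [smul_add, h.e₁_smul_p, e₁_smul_e₁_smul]; abel
    · rwa [map_add, h.i_e₁_smul, hi, add_zero]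
    · rw [smul_add, h.e₁_smul_p, e₁_smul_e₁_smul]; abel
    · rw [map_add] at hv
      rw [add_add_add_comm, ← hyz, hv]; abel

theorem isIndecomposable (h : IsGluing π j i p) (hπ : Function.Surjective π)
    (hX : IsIndecomposable (TriangularAlg A V) X) (hgen : CornerGenerates A V X) :
    IsIndecomposable Λ M :=
  have := hX.1
  ⟨h.nontrivial, fun _ _ hPQ => (hX.2 _ _ (h.isCompl_part hπ hgen hPQ)).imp
    (h.eq_bot_of_part_eq_bot hπ) (h.eq_bot_of_part_eq_bot hπ)⟩

/-- The graph of the correspondence between `X` and `Y` induced by a map of glued modules. -/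
def graph (h : IsGluing π j i p) (h' : IsGluing π j i' p') (hπ : Function.Surjective π)
    (f : M →ₗ[Λ] N) : Submodule (TriangularAlg A V) (X × Y) :=
  submoduleOfStable
    { carrier := {x | f (i x.1) = i' x.2 ∧
        ∃ v, p v = x.1 - e₁ A V • x.1 ∧ p' (f v) = x.2 - e₁ A V • x.2}
      zero_mem' := ⟨by simp, 0, by simp, by simp⟩
      add_mem' := by
        rintro x y ⟨hx, v, hv, hvx⟩ ⟨hy, w, hw, hwy⟩
        refine ⟨?_, v + w, ?_, ?_⟩
        · rw [Prod.fst_add, Prod.snd_add, map_add, map_add, map_add, hx, hy]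
        · rw [map_add, hv, hw, Prod.fst_add, smul_add]; abel
        · rw [map_add, map_add, hvx, hwy, Prod.snd_add, smul_add]; abel
      neg_mem' := by
        rintro x ⟨hx, v, hv, hvx⟩
        refine ⟨?_, -v, ?_, ?_⟩
        · rw [Prod.fst_neg, Prod.snd_neg, map_neg, map_neg, map_neg, hx]
        · rw [map_neg, hv, Prod.fst_neg, smul_neg]; abel
        · rw [map_neg, map_neg, hvx, Prod.snd_neg, smul_neg]; abel }
    (by
      rintro a x ⟨hx, v, hv, hvx⟩
      obtain ⟨r, rfl⟩ := hπ a
      refine ⟨?_, r • v, ?_, ?_⟩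
      · rw [Prod.smul_fst, Prod.smul_snd, h.i_smul, h'.i_smul, map_smul, hx]
      · rw [h.p_smul, hv, smul_sub, Prod.smul_fst, e₁_smul_diag_smul]
      · rw [map_smul, h'.p_smul, hvx, smul_sub, Prod.smul_snd, e₁_smul_diag_smul])
    (by
      rintro x ⟨hx, v, hv, hvx⟩
      refine ⟨?_, 0, ?_, ?_⟩
      · rw [Prod.smul_fst, Prod.smul_snd, h.i_e₁_smul, h'.i_e₁_smul, hx]
      · rw [map_zero, Prod.smul_fst, e₁_smul_e₁_smul, sub_self]
      · rw [map_zero, map_zero, Prod.smul_snd, e₁_smul_e₁_smul, sub_self])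
    (by
      rintro m x ⟨hx, v, hv, hvx⟩
      refine ⟨?_, 0, ?_, ?_⟩
      · rw [Prod.smul_fst, Prod.smul_snd, h.corner_smul_eq m hv, h'.corner_smul_eq m hvx,
          ← h.j_smul, ← h'.j_smul, map_smul]
      · rw [map_zero, Prod.smul_fst, e₁_smul_corner_smul, sub_self]
      · rw [map_zero, map_zero, Prod.smul_snd, e₁_smul_corner_smul, sub_self])

theorem mem_graph {h : IsGluing π j i p} {h' : IsGluing π j i' p'} {hπ : Function.Surjective π}
    {f : M →ₗ[Λ] N} {x : X × Y} : x ∈ h.graph h' hπ f ↔ f (i x.1) = i' x.2 ∧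
      ∃ v, p v = x.1 - e₁ A V • x.1 ∧ p' (f v) = x.2 - e₁ A V • x.2 := Iff.rfl

theorem p_map_i (h : IsGluing π j i p) (h' : IsGluing π j i' p') (hX : CornerGenerates A V X)
    (f : M →ₗ[Λ] N) (x : X) : p' (f (i x)) = 0 := by
  rw [← h.i_e₁_smul]
  refine hX (fun x => p' (f (i x)) = 0) ?_ (by simp) ?_ x
  · intro x y hx hy
    rw [map_add, map_add, map_add, hx, hy, add_zero]
  · intro m x
    obtain ⟨v, hv⟩ := h.exists_p_eq x
    rw [h.corner_smul_eq m hv, ← h.j_smul, map_smul, h'.j_smul, h'.p_i]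

theorem existsUnique_mem_graph (h : IsGluing π j i p) (h' : IsGluing π j i' p')
    (hπ : Function.Surjective π) (hX : CornerGenerates A V X) (f : M →ₗ[Λ] N) (x : X) :
    ∃! y : Y, (x, y) ∈ h.graph h' hπ f := by
  obtain ⟨b, hb⟩ := (h'.p_eq_zero _).mp (h.p_map_i h' hX f x)
  obtain ⟨v, hv⟩ := h.exists_p_eq x
  have hi : ∀ v, i' (p' v) = 0 := fun v => (h'.i_eq_zero _).mpr (h'.e₁_smul_p v)
  refine ⟨e₁ A V • b + p' (f v), mem_graph.mpr ⟨?_, v, hv, ?_⟩, fun y hy => ?_⟩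
  · rw [map_add, h'.i_e₁_smul, hb, hi, add_zero]
  · rw [smul_add, h'.e₁_smul_p, e₁_smul_e₁_smul, add_zero, add_sub_cancel_left]
  · obtain ⟨h1, w, hw, hwy⟩ := mem_graph.mp hy
    have h2 : e₁ A V • y = e₁ A V • b := by
      rw [← sub_eq_zero, ← smul_sub, ← h'.i_eq_zero, map_sub, hb, ← h1, sub_self]
    have h3 : p' (f w) = p' (f v) := by
      obtain ⟨c, hc⟩ := (h.p_eq_zero (w - v)).mp (by rw [map_sub, hw, hv, sub_self])
      rw [← sub_eq_zero, ← map_sub, ← map_sub, ← hc, h.p_map_i h' hX]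
    rw [← h2, ← h3, hwy]; abel

theorem nonempty_linearEquiv (h : IsGluing π j i p) (h' : IsGluing π j i' p')
    (hπ : Function.Surjective π) (hX : CornerGenerates A V X) (hY : CornerGenerates A V Y)
    (f : M ≃ₗ[Λ] N) : Nonempty (X ≃ₗ[TriangularAlg A V] Y) := by
  have swap : ∀ x y, (x, y) ∈ h.graph h' hπ f.toLinearMap ↔
      (y, x) ∈ h'.graph h hπ f.symm.toLinearMap := by
    intro x y
    rw [mem_graph, mem_graph]
    refine and_congr ?_ ⟨?_, ?_⟩
    · exact ⟨fun h => by simp [← h], fun h => by simp [← h]⟩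
    · rintro ⟨v, hv, hv'⟩
      exact ⟨f v, hv', by simpa using hv⟩
    · rintro ⟨v, hv, hv'⟩
      exact ⟨f.symm v, hv', by simpa using hv⟩
  have h1 := h.existsUnique_mem_graph h' hπ hX f.toLinearMap
  have h2 := h'.existsUnique_mem_graph h hπ hY f.symm.toLinearMap
  simp only [← swap] at h2
  set G := h.graph h' hπ f.toLinearMap
  have b1 : Function.Bijective ((LinearMap.fst (TriangularAlg A V) X Y).comp G.subtype) := by
    constructor
    · rintro ⟨⟨x, y⟩, hxy⟩ ⟨⟨x', y'⟩, hxy'⟩ (rfl : x = x')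
      have := (h1 x).unique hxy hxy'
      subst this
      rfl
    · intro x
      obtain ⟨y, hy⟩ := (h1 x).exists
      exact ⟨⟨(x, y), hy⟩, rfl⟩
  have b2 : Function.Bijective ((LinearMap.snd (TriangularAlg A V) X Y).comp G.subtype) := by
    constructor
    · rintro ⟨⟨x, y⟩, hxy⟩ ⟨⟨x', y'⟩, hxy'⟩ (rfl : y = y')
      have := (h2 y).unique hxy hxy'
      subst this
      rfl
    · intro y
      obtain ⟨x, hx⟩ := (h2 y).exists
      exact ⟨⟨(x, y), hx⟩, rfl⟩
  exact ⟨(LinearEquiv.ofBijective _ b1).symm.trans (LinearEquiv.ofBijective _ b2)⟩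

end IsGluing

section Restriction

variable [Module Λ X] [Module Λ Y]

/-- A submodule over the triangular matrix algebra as a submodule over `Λ`. -/
def restrict (hX : ∀ (r : Λ) (x : X), r • x = diag A V (π r) • x)
    (N : Submodule (TriangularAlg A V) X) : Submodule Λ X where
  __ := N.toAddSubgroup
  smul_mem' r x hx := by
    rw [hX]
    exact N.smul_mem _ hx

theorem mem_restrict {hX : ∀ (r : Λ) (x : X), r • x = diag A V (π r) • x}
    {N : Submodule (TriangularAlg A V) X} {x : X} : x ∈ restrict hX N ↔ x ∈ N := Iff.rfl

theorem covBy_restrict (hπ : Function.Surjective π)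
    (hX : ∀ (r : Λ) (x : X), r • x = diag A V (π r) • x)
    {N L : Submodule (TriangularAlg A V) X} (h : N ⋖ L) : restrict hX N ⋖ restrict hX L := by
  have hNL : ∀ x ∈ N, x ∈ L := h.le
  -- one of the two idempotents maps `L` into `N`
  have key : (∀ x ∈ L, e₁ A V • x ∈ N) ∨ (∀ x ∈ L, x - e₁ A V • x ∈ N) := by
    let D : Submodule (TriangularAlg A V) X := submoduleOfStable
      { carrier := {x | x ∈ L ∧ x - e₁ A V • x ∈ N}
        zero_mem' := ⟨L.zero_mem, by simp⟩
        add_mem' := by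
          rintro x y ⟨hx, hx'⟩ ⟨hy, hy'⟩
          refine ⟨L.add_mem hx hy, ?_⟩
          rw [smul_add, add_sub_add_comm]
          exact N.add_mem hx' hy'
        neg_mem' := by
          rintro x ⟨hx, hx'⟩
          refine ⟨L.neg_mem hx, ?_⟩
          rw [smul_neg, neg_sub_neg, ← neg_sub]
          exact N.neg_mem hx' }
      (by
        rintro a x ⟨hx, hx'⟩
        refine ⟨L.smul_mem _ hx, ?_⟩
        rw [e₁_smul_diag_smul, ← smul_sub]
        exact N.smul_mem _ hx')
      (by
        rintro x ⟨hx, -⟩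
        refine ⟨L.smul_mem _ hx, ?_⟩
        rw [e₁_smul_e₁_smul, sub_self]
        exact N.zero_mem)
      (by
        rintro m x ⟨hx, -⟩
        refine ⟨L.smul_mem _ hx, ?_⟩
        rw [e₁_smul_corner_smul, sub_self]
        exact N.zero_mem)
    have h1 : N ≤ D := fun x hx => ⟨hNL x hx, N.sub_mem hx (N.smul_mem _ hx)⟩
    have h2 : D ≤ L := fun x hx => hx.1
    rcases h.eq_or_eq h1 h2 with hD | hD
    · refine Or.inl fun x hx => ?_
      rw [← hD]
      refine ⟨L.smul_mem _ hx, ?_⟩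
      rw [e₁_smul_e₁_smul, sub_self]
      exact N.zero_mem
    · refine Or.inr fun x hx => ?_
      rw [← hD] at hx
      exact hx.2
  have hcorner : ∀ m : V, ∀ x ∈ L, corner A m • x ∈ N := by
    intro m x hx
    rcases key with key | key
    · rw [← e₁_smul_corner_smul]
      exact key _ (L.smul_mem _ hx)
    · have := N.smul_mem (corner A m) (key x hx)
      rwa [smul_sub, corner_smul_e₁_smul, sub_zero] at this
  refine ⟨lt_of_le_of_ne h.le fun hE => h.ne ?_, fun K hK1 hK2 => ?_⟩
  · ext x
    rw [← mem_restrict (hX := hX), hE, mem_restrict]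
  · have hNK : ∀ x ∈ N, x ∈ K := hK1.le
    have hKL : ∀ x ∈ K, x ∈ L := hK2.le
    let K' : Submodule (TriangularAlg A V) X := submoduleOfStable K.toAddSubgroup
      (by
        intro a x hx
        obtain ⟨r, rfl⟩ := hπ a
        rw [← hX]
        exact K.smul_mem r hx)
      (by
        intro x hx
        rcases key with key | key
        · exact hNK _ (key x (hKL x hx))
        · have := K.sub_mem hx (hNK _ (key x (hKL x hx)))
          rwa [sub_sub_cancel] at this)
      (fun m x hx => hNK _ (hcorner m x (hKL x hx)))
    exact h.2 (c := K') hK1 hK2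

theorem quotIso_restrict (hX : ∀ (r : Λ) (x : X), r • x = diag A V (π r) • x)
    (hY : ∀ (r : Λ) (y : Y), r • y = diag A V (π r) • y)
    {a b : Submodule (TriangularAlg A V) X} {c d : Submodule (TriangularAlg A V) Y}
    (h : QuotIso (TriangularAlg A V) a b c d) :
    QuotIso Λ (restrict hX a) (restrict hX b) (restrict hY c) (restrict hY d) := by
  obtain ⟨e⟩ := h
  let e' : (↥(restrict hX b) ⧸ Submodule.comap (restrict hX b).subtype (restrict hX a)) ≃+
      (↥(restrict hY d) ⧸ Submodule.comap (restrict hY d).subtype (restrict hY c)) :=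
    e.toAddEquiv
  refine ⟨{ e' with map_smul' := ?_ }⟩
  intro r z
  obtain ⟨x, rfl⟩ := Submodule.mkQ_surjective _ z
  obtain ⟨x, hx⟩ := x
  have h1 : ∀ (x : X) (hx : x ∈ b), (⟨r • x, (restrict hX b).smul_mem r hx⟩ : b) =
    diag A V (π r) • (⟨x, hx⟩ : b) := fun x hx => Subtype.ext (hX r x)
  have h2 : ∀ (y : Y) (hy : y ∈ d), (⟨r • y, (restrict hY d).smul_mem r hy⟩ : d) =
    diag A V (π r) • (⟨y, hy⟩ : d) := fun y hy => Subtype.ext (hY r y)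
  obtain ⟨⟨y, hy⟩, hxy⟩ := Submodule.mkQ_surjective _ (e (Submodule.Quotient.mk ⟨x, hx⟩))
  change e (Submodule.Quotient.mk ⟨r • x, _⟩) = r • e' (Submodule.Quotient.mk ⟨x, hx⟩)
  have h3 : e' (Submodule.Quotient.mk ⟨x, hx⟩) =
    (Submodule.Quotient.mk (⟨y, hy⟩ : restrict hY d)) := hxy.symm
  rw [h1 x hx, h3]
  have h4 := e.map_smul (diag A V (π r)) (Submodule.Quotient.mk (⟨x, hx⟩ : b))
  rw [← hxy] at h4
  refine Eq.trans h4 ?_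
  exact (congrArg (Submodule.Quotient.mk (p := Submodule.comap d.subtype c)) (h2 y hy)).symm

theorem sameCompFactors_restrict (hπ : Function.Surjective π)
    (hX : ∀ (r : Λ) (x : X), r • x = diag A V (π r) • x)
    (hY : ∀ (r : Λ) (y : Y), r • y = diag A V (π r) • y)
    (h : SameCompFactors (TriangularAlg A V) X Y) : SameCompFactors Λ X Y := by
  obtain ⟨s, t, h1, h2, h3, h4, e, he⟩ := h
  have bot : ∀ {Z : Type} [AddCommGroup Z] [Module (TriangularAlg A V) Z] [Module Λ Z]
      (hZ : ∀ (r : Λ) (z : Z), r • z = diag A V (π r) • z), restrict hZ ⊥ = ⊥ := by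
    intros; ext; simp [mem_restrict]
  have top : ∀ {Z : Type} [AddCommGroup Z] [Module (TriangularAlg A V) Z] [Module Λ Z]
      (hZ : ∀ (r : Λ) (z : Z), r • z = diag A V (π r) • z), restrict hZ ⊤ = ⊤ := by
    intros; ext; simp [mem_restrict]
  exact ⟨⟨s.length, fun i => restrict hX (s i), fun i => covBy_restrict hπ hX (s.step i)⟩,
    ⟨t.length, fun i => restrict hY (t i), fun i => covBy_restrict hπ hY (t.step i)⟩,
    (congrArg _ h1).trans (bot hX), (congrArg _ h2).trans (top hX),
    (congrArg _ h3).trans (bot hY), (congrArg _ h4).trans (top hY),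
    e, fun i => quotIso_restrict hX hY (he i)⟩

theorem IsGluing.sameCompFactors {i : X →+ M} {p : M →+ X} (h : IsGluing π j i p)
    (hX : ∀ (r : Λ) (x : X), r • x = diag A V (π r) • x) (hfl : IsFiniteLength Λ X) :
    SameCompFactors Λ M X := by
  let B : Submodule Λ X :=
    { carrier := {x | e₁ A V • x = x}
      zero_mem' := smul_zero _
      add_mem' := fun {x y} hx hy => by
        rw [Set.mem_ofPred_eq] at *
        rw [smul_add, hx, hy]
      smul_mem' := fun r x hx => by
        rw [Set.mem_ofPred_eq] at *
        rw [hX, e₁_smul_diag_smul, hx] }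
  have hB : ∀ x, x ∈ B ↔ e₁ A V • x = x := fun _ => Iff.rfl
  let iL : X →ₗ[Λ] M := { i with map_smul' := fun r x => by simpa [hX] using h.i_smul r x }
  let pL : M →ₗ[Λ] X := { p with map_smul' := fun r x => by simpa [hX] using h.p_smul r x }
  refine SameCompFactors.of_exact (B := B) (A := X ⧸ B)
    (hfl.of_injective B.subtype_injective) (hfl.of_surjective B.mkQ_surjective) M X
    (iL.comp B.subtype) (B.mkQ.comp pL) B.subtype B.mkQ ?_ ?_ ?_ B.subtype_injective
    (LinearMap.exact_subtype_mkQ B) B.mkQ_surjective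
  · rw [injective_iff_map_eq_zero]
    rintro ⟨x, hx⟩ h0
    have h1 := (h.i_eq_zero x).mp h0
    rw [(hB x).mp hx] at h1
    exact Subtype.ext h1
  · intro v
    rw [LinearMap.comp_apply, Submodule.mkQ_apply, Submodule.Quotient.mk_eq_zero, hB]
    change e₁ A V • p v = p v ↔ _
    rw [h.e₁_smul_p, eq_comm, h.p_eq_zero]
    constructor
    · rintro ⟨x, rfl⟩
      exact ⟨⟨e₁ A V • x, e₁_smul_e₁_smul x⟩, h.i_e₁_smul x⟩
    · rintro ⟨x, rfl⟩
      exact ⟨x, rfl⟩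
  · intro z
    obtain ⟨x, rfl⟩ := B.mkQ_surjective z
    obtain ⟨v, hv⟩ := h.exists_p_eq x
    refine ⟨v, ?_⟩
    change B.mkQ (p v) = _
    rw [hv, ← sub_eq_zero, ← map_sub, Submodule.mkQ_apply, Submodule.Quotient.mk_eq_zero, hB,
      sub_sub_cancel_left, smul_neg, e₁_smul_e₁_smul]

end Restriction

/-- A gluing of `X`, built from a presentation `N → F → X` of the restriction of `X` and
a section `s` of `X` over the reduction `G` of `F`. -/
theorem exists_isGluing_of_presentation {X F G N : Type} [AddCommGroup X]
    [Module (TriangularAlg A V) X] [Module A X] [Module Λ X] [AddCommGroup F] [Module Λ F]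
    [AddCommGroup G] [Module A G] [AddCommGroup N]
    (hA : ∀ (a : A) (x : X), a • x = diag A V a • x)
    (hΛ : ∀ (r : Λ) (x : X), r • x = diag A V (π r) • x) (hπj : ∀ m, π (j m) = 0)
    (s : X →ₗ[A] G) (lin : F →ₗ[Λ] X) (red : F →+ G) (jj : N →+ F) (ψ : N →+ X)
    (red_smul : ∀ (r : Λ) f, red (r • f) = π r • red f)
    (ex_red : ∀ x, ∃ f, red f = s x ∧ lin f = x)
    (lin_jj : ∀ n, lin (jj n) = 0) (jj_inj : ∀ n, jj n = 0 → n = 0)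
    (ex_jj : ∀ f, red f = 0 → ∃ n, jj n = f)
    (e_ψ : ∀ n, e₁ A V • ψ n = ψ n)
    (ex_smul : ∀ (r : Λ) n, ∃ n', jj n' = r • jj n ∧ ψ n' = r • ψ n)
    (ex_j_smul : ∀ m f, ∃ n, jj n = j m • f ∧ ψ n = corner A m • lin f) :
    ∃ (M : Type) (_ : AddCommGroup M) (_ : Module Λ M) (i : X →+ M) (p : M →+ X),
      IsGluing π j i p := by
  let P : Submodule Λ (F × X) :=
    { carrier := {w | e₁ A V • w.2 = w.2 ∧ e₁ A V • lin w.1 = 0 ∧ red w.1 = s (lin w.1)}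
      zero_mem' := by simp
      add_mem' := by
        rintro v w ⟨h1, h2, h3⟩ ⟨h4, h5, h6⟩
        refine ⟨?_, ?_, ?_⟩
        · rw [Prod.snd_add, smul_add, h1, h4]
        · rw [Prod.fst_add, map_add, smul_add, h2, h5, add_zero]
        · rw [Prod.fst_add, map_add, map_add, map_add, h3, h6]
      smul_mem' := by
        rintro r w ⟨h1, h2, h3⟩
        refine ⟨?_, ?_, ?_⟩
        · rw [Prod.smul_snd, hΛ, e₁_smul_diag_smul, h1]
        · rw [Prod.smul_fst, map_smul, hΛ, e₁_smul_diag_smul, h2, smul_zero]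
        · rw [Prod.smul_fst, red_smul, h3, lin.map_smul, hΛ, ← hA, s.map_smul] }
  let W : Submodule Λ P :=
    { carrier := {w | ∃ n, w.1.1 = jj n ∧ w.1.2 = -ψ n}
      zero_mem' := ⟨0, by simp, by simp⟩
      add_mem' := by
        rintro v w ⟨m, h1, h2⟩ ⟨n, h3, h4⟩
        refine ⟨m + n, ?_, ?_⟩
        · rw [map_add, ← h1, ← h3]; rfl
        · rw [map_add, neg_add, ← h2, ← h4]; rfl
      smul_mem' := by
        rintro r w ⟨n, h1, h2⟩
        obtain ⟨n', h3, h4⟩ := ex_smul r n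
        refine ⟨n', ?_, ?_⟩
        · rw [h3, ← h1]; rfl
        · rw [h4, ← smul_neg, ← h2]; rfl }
  have mem_W : ∀ w : P, w ∈ W ↔ ∃ n, w.1.1 = jj n ∧ w.1.2 = -ψ n := fun _ => Iff.rfl
  let ι : X →+ P :=
    { toFun := fun x => ⟨(0, e₁ A V • x), e₁_smul_e₁_smul x, by simp, by simp⟩
      map_zero' := Subtype.ext (by simp)
      map_add' := fun x y => Subtype.ext (by simp) }
  let q : P →ₗ[Λ] X := lin.comp ((LinearMap.fst Λ _ _).comp P.subtype)
  have hWq : W ≤ LinearMap.ker q := by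
    rintro w ⟨n, h1, -⟩
    change lin w.1.1 = 0
    rw [h1, lin_jj]
  refine ⟨P ⧸ W, inferInstance, inferInstance, W.mkQ.toAddMonoidHom.comp ι,
    (W.liftQ q hWq).toAddMonoidHom, ?_, ?_, ?_, ?_, ?_, ?_, ?_⟩
  · intro r x
    change W.mkQ (ι _) = r • W.mkQ (ι x)
    rw [← map_smul]
    congr 1
    refine Subtype.ext (Prod.ext (smul_zero r).symm ?_)
    exact (e₁_smul_diag_smul (A := A) (V := V) (π r) x).trans (hΛ r _).symm
  · intro r v
    exact ((W.liftQ q hWq).map_smul r v).trans (hΛ r _)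
  · intro x
    change W.mkQ (ι x) = 0 ↔ _
    rw [Submodule.mkQ_apply, Submodule.Quotient.mk_eq_zero, mem_W]
    constructor
    · rintro ⟨n, h1, h2⟩
      rw [jj_inj n h1.symm, map_zero, neg_zero] at h2
      exact h2
    · intro hx
      exact ⟨0, (map_zero jj).symm, by rw [map_zero, neg_zero]; exact hx⟩
  · intro v
    obtain ⟨w, rfl⟩ := W.mkQ_surjective v
    exact w.2.2.1
  · intro x hx
    obtain ⟨f, hf, hlin⟩ := ex_red x
    exact ⟨W.mkQ ⟨(f, 0), smul_zero _, by rw [hlin, hx], by rw [hf, hlin]⟩, hlin⟩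
  · intro v
    constructor
    · obtain ⟨w, rfl⟩ := W.mkQ_surjective v
      intro hw
      have hw' : lin w.1.1 = 0 := hw
      obtain ⟨n, hn⟩ := ex_jj w.1.1 (by rw [w.2.2.2, hw', map_zero])
      refine ⟨w.1.2 + ψ n, ?_⟩
      change W.mkQ (ι _) = W.mkQ w
      rw [← sub_eq_zero, ← neg_eq_zero, ← map_sub, ← map_neg, Submodule.mkQ_apply,
        Submodule.Quotient.mk_eq_zero, mem_W]
      refine ⟨n, ?_, ?_⟩
      · change -(0 - w.1.1) = _
        rw [hn]; abel
      · change -(e₁ A V • (w.1.2 + ψ n) - w.1.2) = _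
        rw [smul_add, e_ψ, w.2.1]; abel
    · rintro ⟨x, rfl⟩
      exact map_zero lin
  · intro m v
    obtain ⟨w, rfl⟩ := W.mkQ_surjective v
    change j m • W.mkQ w = W.mkQ (ι (corner A m • lin w.1.1))
    obtain ⟨n, h1, h2⟩ := ex_j_smul m w.1.1
    rw [← sub_eq_zero, ← map_smul, ← map_sub, Submodule.mkQ_apply,
      Submodule.Quotient.mk_eq_zero, mem_W]
    refine ⟨n, ?_, ?_⟩
    · change j m • w.1.1 - 0 = _
      rw [h1, sub_zero]
    · change j m • w.1.2 - e₁ A V • (corner A m • lin w.1.1) = _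
      rw [hΛ, hπj, map_zero, zero_smul, zero_sub, e₁_smul_corner_smul, h2]

theorem exists_isGluing_of_smul_eq [IsSemisimpleRing A] (hj : IsSquareZeroCover π j)
    (X : Type) [AddCommGroup X] [Module (TriangularAlg A V) X] [Module A X] [Module Λ X]
    (hA : ∀ (a : A) (x : X), a • x = diag A V a • x)
    (hΛ : ∀ (r : Λ) (x : X), r • x = diag A V (π r) • x) :
    ∃ (M : Type) (_ : AddCommGroup M) (_ : Module Λ M) (i : X →+ M) (p : M →+ X),
      IsGluing π j i p := by
  have hπj : ∀ m, π (j m) = 0 := fun m => (hj.map_eq_zero_iff _).mpr ⟨m, rfl⟩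
  obtain ⟨s, hs⟩ := Module.projective_def'.mp (Module.projective_of_isSemisimpleRing A X)
  let lin : (X →₀ Λ) →ₗ[Λ] X := Finsupp.linearCombination Λ id
  let red : (X →₀ Λ) →+ (X →₀ A) := Finsupp.mapRange.addMonoidHom π.toAddMonoidHom
  let jj : (X →₀ V) →+ (X →₀ Λ) := Finsupp.mapRange.addMonoidHom j
  let ψ : (X →₀ V) →+ X := Finsupp.liftAddHom fun c =>
    { toFun := fun m => corner A m • c
      map_zero' := by rw [corner_zero, zero_smul]
      map_add' := fun m n => by rw [corner_add, add_smul] }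
  have red_smul : ∀ (r : Λ) f, red (r • f) = π r • red f := by
    intro r f; ext c; simp [red]
  have lin_red : ∀ f, lin f = Finsupp.linearCombination A id (red f) := by
    intro f
    induction f using Finsupp.induction_linear with
    | zero => simp
    | add f g hf hg => rw [map_add, map_add, map_add, hf, hg]
    | single c r => simp [lin, red, hΛ, hA]
  have lin_jj : ∀ n, lin (jj n) = 0 := by
    intro n
    induction n using Finsupp.induction_linear with
    | zero => simp
    | add f g hf hg => rw [map_add, map_add, hf, hg, add_zero]
    | single c r => simp [lin, jj, hΛ, hπj]
  have jj_inj : ∀ n, jj n = 0 → n = 0 := by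
    intro n hn
    ext c
    apply hj.injective
    simpa [jj] using DFunLike.congr_fun hn c
  have ex_jj : ∀ f, red f = 0 → ∃ n, jj n = f := by
    have hg : ∀ r, ∃ m, (π r = 0 → j m = r) ∧ (r = 0 → m = 0) := by
      intro r
      by_cases hr : π r = 0
      · obtain ⟨m, rfl⟩ := (hj.map_eq_zero_iff r).mp hr
        exact ⟨m, fun _ => rfl, fun h0 => hj.injective (by rw [h0, map_zero])⟩
      · exact ⟨0, fun h0 => absurd h0 hr, fun _ => rfl⟩
    choose g hg hg0 using hg
    intro f hf
    refine ⟨Finsupp.mapRange g (hg0 0 rfl) f, ?_⟩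
    ext c
    exact hg _ (DFunLike.congr_fun hf c)
  have ψ_single : ∀ c m, ψ (Finsupp.single c m) = corner A m • c := fun c m =>
    Finsupp.liftAddHom_apply_single _ c m
  have e_ψ : ∀ n, e₁ A V • ψ n = ψ n := by
    intro n
    induction n using Finsupp.induction_linear with
    | zero => simp
    | add f g hf hg => rw [map_add, smul_add, hf, hg]
    | single c r => rw [ψ_single]; exact e₁_smul_corner_smul (A := A) r c
  have ex_smul : ∀ (r : Λ) n, ∃ n', jj n' = r • jj n ∧ ψ n' = r • ψ n := by
    intro r n
    induction n using Finsupp.induction_linear with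
    | zero => exact ⟨0, by simp, by simp⟩
    | add f g hf hg =>
      obtain ⟨f', h1, h2⟩ := hf
      obtain ⟨g', h3, h4⟩ := hg
      exact ⟨f' + g', by rw [map_add, h1, h3, map_add, smul_add],
        by rw [map_add, h2, h4, map_add, smul_add]⟩
    | single c m =>
      refine ⟨Finsupp.single c (π r • m), ?_, ?_⟩
      · simp [jj, hj.left_smul]
      · rw [ψ_single, ψ_single, hΛ, diag_smul_corner_smul]
  have ex_j_smul : ∀ m f, ∃ n, jj n = j m • f ∧ ψ n = corner A m • lin f := by
    intro m f
    induction f using Finsupp.induction_linear with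
    | zero => exact ⟨0, by simp, by simp⟩
    | add f g hf hg =>
      obtain ⟨f', h1, h2⟩ := hf
      obtain ⟨g', h3, h4⟩ := hg
      exact ⟨f' + g', by rw [map_add, h1, h3, smul_add],
        by rw [map_add, h2, h4, map_add, smul_add]⟩
    | single c r =>
      refine ⟨Finsupp.single c (MulOpposite.op (π r) • m), ?_, ?_⟩
      · simp [jj, hj.right_smul]
      · rw [ψ_single]; simp [lin, hΛ, corner_smul_diag_smul]
  refine exists_isGluing_of_presentation hA hΛ hπj s lin red jj ψ red_smul ?_ lin_jj jj_inj ex_jj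
    e_ψ ex_smul ex_j_smul
  intro x
  obtain ⟨f, hf⟩ : ∃ f, red f = s x :=
    Finsupp.mapRange_surjective π (map_zero π) hj.surjective (s x)
  refine ⟨f, hf, ?_⟩
  rw [lin_red, hf]
  exact LinearMap.congr_fun hs x

theorem exists_isGluing [IsSemisimpleRing A] (hj : IsSquareZeroCover π j)
    (X : Type) [AddCommGroup X] [Module (TriangularAlg A V) X] :
    ∃ (M : Type) (_ : AddCommGroup M) (_ : Module Λ M) (i : X →+ M) (p : M →+ X),
      IsGluing π j i p :=
  @exists_isGluing_of_smul_eq A V _ _ _ _ _ Λ _ π j _ hj X _ _ (diagModule (V := V))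
    (Module.compHom X ((diag A V).comp π)) (fun _ _ => rfl) (fun _ _ => rfl)

end TriangularAlg

open TriangularAlg

/-- for an Artin algebra `Λ` with Jacobson radical `J` satisfying `J² = 0`,
property 𝔛 for `Λ` implies property 𝔛 for the triangular matrix algebra
`Γ = [[Λ/J, J], [0, Λ/J]]`.  Here `A` plays the role of `Λ/J` (via the surjection `π`
with kernel `J`) and `M'` the role of `J` as an `A`-bimodule (via `j`). -/
theorem stmt_16 (k Λ : Type) [CommRing k] [IsArtinianRing k] [Ring Λ] [Algebra k Λ]
    [Module.Finite k Λ]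
    (A M' : Type) [Ring A] [AddCommGroup M'] [Module A M'] [Module Aᵐᵒᵖ M']
    [SMulCommClass A Aᵐᵒᵖ M']
    (π : Λ →+* A) (hπ : Function.Surjective π)
    (hker : ∀ x : Λ, π x = 0 ↔ x ∈ (⊥ : Ideal Λ).jacobson)
    (hJ2 : ∀ x ∈ (⊥ : Ideal Λ).jacobson, ∀ y ∈ (⊥ : Ideal Λ).jacobson, x * y = 0)
    (j : M' ≃+ (⊥ : Ideal Λ).jacobson)
    (hjl : ∀ (x : Λ) (m : M'), (j (π x • m) : Λ) = x * (j m : Λ))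
    (hjr : ∀ (x : Λ) (m : M'), (j (MulOpposite.op (π x) • m) : Λ) = (j m : Λ) * x)
    (hΛ : PropertyX Λ) :
    PropertyX (TriangularAlg A M') := by
  have hA : IsSemisimpleRing A := by
    have : IsArtinianRing Λ := IsArtinianRing.of_finite k Λ
    let f : Λ ⧸ Ring.jacobson Λ →+* A := Ideal.Quotient.lift _ π fun x hx =>
      (hker x).mpr (by rwa [Ideal.jacobson_bot])
    exact RingHom.isSemisimpleRing_of_surjective f
      (Ideal.Quotient.lift_surjective_of_surjective _ _ hπ)
  let j' : M' →+ Λ := (Submodule.subtype _).toAddMonoidHom.comp j.toAddMonoidHom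
  have hj : IsSquareZeroCover π j' :=
    { surjective := hπ
      injective := Subtype.val_injective.comp j.injective
      map_eq_zero_iff := fun x => by
        rw [hker]
        refine ⟨fun hx => ⟨j.symm ⟨x, hx⟩, ?_⟩, ?_⟩
        · exact congrArg Subtype.val (j.apply_symm_apply ⟨x, hx⟩)
        · rintro ⟨m, rfl⟩
          exact (j m).2
      left_smul := hjl
      right_smul := hjr }
  intro X Y _ _ _ _ hXfl hYfl hX hY h
  rcases isSimpleModule_or_cornerGenerates hX with hXs | hXg
  · exact h.nonempty_linearEquiv hXs
  rcases isSimpleModule_or_cornerGenerates hY with hYs | hYg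
  · obtain ⟨e⟩ := h.symm.nonempty_linearEquiv hYs
    exact ⟨e.symm⟩
  obtain ⟨M, _, _, i, p, hM⟩ := exists_isGluing hj X
  obtain ⟨N, _, _, i', p', hN⟩ := exists_isGluing hj Y
  let _ : Module Λ X := Module.compHom X ((diag A M').comp π)
  let _ : Module Λ Y := Module.compHom Y ((diag A M').comp π)
  have hXY : SameCompFactors Λ X Y :=
    sameCompFactors_restrict hπ (fun _ _ => rfl) (fun _ _ => rfl) h
  have hMX : SameCompFactors Λ M X := hM.sameCompFactors (fun _ _ => rfl) hXY.isFiniteLength_left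
  have hNY : SameCompFactors Λ N Y :=
    hN.sameCompFactors (fun _ _ => rfl) hXY.symm.isFiniteLength_left
  obtain ⟨f⟩ := hΛ M N hMX.isFiniteLength_left hNY.isFiniteLength_left
    (hM.isIndecomposable hπ hX hXg) (hN.isIndecomposable hπ hY hYg)
    (hMX.trans (hXY.trans hNY.symm))
  exact hM.nonempty_linearEquiv hN hπ hXg hYg f
end
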